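/- Fix a real γ with 0 < γ ≤ 1/50 and a real δ > 0. For each m let r_m = ⌈γ·m⌉, let R_m = 2^{-m}·binom(m, ≤ r_m), and let p_m = 1 - (1+δ)·R_m. Let S_m ⊆ F₂^m be the random set obtained by including each point of F₂^m independently with probability p_m (the erased points). Then the probability that there exists a nonzero f ∈ P(m, r_m) with supp(f) ⊆ S_m tends to 0 as m → ∞. (Equivalently, RM(m, ⌈γm⌉) recovers with high probability from BEC(p_m) erasures, i.e. it achieves capacity for the binary erasure channel.) -/

import Mathlib

open Finset

abbrev Cube (m : ℕ) := Fin m → ZMod 2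
abbrev BF (m : ℕ) := Cube m → ZMod 2

/-- Codewords of RM(m,r): functions computed by a polynomial of total degree ≤ r. -/
def RM (m r : ℕ) : Set (BF m) :=
  {f | ∃ p : MvPolynomial (Fin m) (ZMod 2), p.totalDegree ≤ r ∧
    ∀ x, MvPolynomial.eval x p = f x}

/-- Normalized weight of a Boolean function. -/
noncomputable def wt {m : ℕ} (f : BF m) : ℝ :=
  ((univ.filter fun x => f x = 1).card : ℝ) / 2 ^ m

/-- Bias of a Boolean function. -/
noncomputable def bias {m : ℕ} (f : BF m) : ℝ :=
  (∑ x : Cube m, if f x = 0 then (1 : ℝ) else -1) / 2 ^ m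

/-- Number of codewords of RM(m,r) of weight at most β. -/
noncomputable def W (m r : ℕ) (β : ℝ) : ℕ :=
  Set.ncard {f : BF m | f ∈ RM m r ∧ wt f ≤ β}

/-- binom(n, ≤ k) = ∑_{i=0}^k C(n,i). -/
def binomLe (n k : ℕ) : ℕ := ∑ i ∈ Finset.range (k + 1), n.choose i

open scoped Classical

/-- Probability, when each point of F₂^m is erased independently with
probability p, that some nonzero codeword of RM(m,r) is supported on the
erased set (exactly the event that the erasure pattern is not uniquely
decodable). -/
noncomputable def erasureFailProb (m r : ℕ) (p : ℝ) : ℝ :=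
  ∑ S : Finset (Cube m),
    p ^ S.card * (1 - p) ^ (2 ^ m - S.card) *
      (if ∃ f ∈ RM m r, f ≠ 0 ∧ ∀ x, f x ≠ 0 → x ∈ S then 1 else 0)

/-- Probability, for a random error vector v with independent Bernoulli(p)
coordinates, that some nonzero codeword f of RM(m,r) satisfies
|v + F_f| ≤ |v| (the event containing maximum-likelihood decoding failure). -/
noncomputable def bscFailProb (m r : ℕ) (p : ℝ) : ℝ :=
  ∑ v : BF m,
    p ^ hammingNorm v * (1 - p) ^ (2 ^ m - hammingNorm v) *
      (if ∃ f ∈ RM m r, f ≠ 0 ∧ hammingNorm (v + f) ≤ hammingNorm v then 1 else 0)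

/-- Binary entropy function (base-2 logarithm). -/
noncomputable def binH (p : ℝ) : ℝ :=
  -p * Real.logb 2 p - (1 - p) * Real.logb 2 (1 - p)

lemma RM_zero_mem (m r : ℕ) : (0 : BF m) ∈ RM m r :=
  ⟨0, by simp, fun x => by simp⟩

/-- The code `RM m r` as a submodule of the space of Boolean functions. -/
def rmSubmodule (m r : ℕ) : Submodule (ZMod 2) (BF m) where
  carrier := RM m r
  zero_mem' := RM_zero_mem m r
  add_mem' := by
    rintro f g ⟨p, hp, hpf⟩ ⟨q, hq, hqg⟩
    exact ⟨p + q, (MvPolynomial.totalDegree_add p q).trans (max_le hp hq), fun x => by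
      simp [hpf, hqg]⟩
  smul_mem' := by
    rintro c f ⟨p, hp, hpf⟩
    exact ⟨c • p, (MvPolynomial.totalDegree_smul_le c p).trans hp, fun x => by
      simp [hpf, MvPolynomial.smul_eval]⟩

lemma mem_rmSubmodule {m r : ℕ} {f : BF m} : f ∈ rmSubmodule m r ↔ f ∈ RM m r := Iff.rfl

/-- The product of the linear forms `L i`, `i ∈ S`, has degree at most `S.card`. -/
lemma prod_linear_mem_RM {m n r : ℕ} (L : Cube m →ₗ[ZMod 2] Cube n) (S : Finset (Fin n))
    (hS : S.card ≤ r) : (fun x => ∏ i ∈ S, L x i) ∈ RM m r := by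
  refine ⟨∏ i ∈ S, ∑ j : Fin m, MvPolynomial.C (L (Pi.single j 1) i) * MvPolynomial.X j, ?_, ?_⟩
  · refine (MvPolynomial.totalDegree_finsetProd _ _).trans ?_
    refine (Finset.sum_le_card_nsmul _ _ 1 fun i _ => ?_).trans (by simpa using hS)
    refine MvPolynomial.totalDegree_finsetSum_le fun j _ => ?_
    refine (MvPolynomial.totalDegree_mul _ _).trans ?_
    simp [MvPolynomial.totalDegree_X]
  · intro x
    rw [map_prod]
    refine Finset.prod_congr rfl fun i _ => ?_
    have : L x = ∑ j, x j • L (Pi.single j 1) := by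
      conv_lhs => rw [pi_eq_sum_univ' x]
      simp [map_sum, Pi.single]
    rw [this]
    simp [mul_comm]

/-- Evaluation of a multilinear polynomial with coefficients indexed by the sets of size `≤ r`. -/
def anf (m r : ℕ) : ({S : Finset (Fin m) // S.card ≤ r} → ZMod 2) →ₗ[ZMod 2] BF m where
  toFun c x := ∑ S, c S * ∏ i ∈ S.1, x i
  map_add' c d := by ext x; simp [add_mul, sum_add_distrib]
  map_smul' a c := by ext x; simp [mul_assoc, mul_sum]

lemma anf_apply {m r : ℕ} (c) (x : Cube m) : anf m r c x = ∑ S, c S * ∏ i ∈ S.1, x i := rfl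

lemma anf_injective (m r : ℕ) : Function.Injective (anf m r) := by
  rw [injective_iff_map_eq_zero]
  intro c hc
  by_contra hne
  obtain ⟨S, hS, hmin⟩ := exists_min_image (univ.filter fun S => c S ≠ 0) (fun S => S.1.card) (by
    by_contra h
    rw [not_nonempty_iff_eq_empty, filter_eq_empty_iff] at h
    exact hne (funext fun S => by simpa using h (mem_univ S)))
  have h := congr_fun hc fun i => if i ∈ S.1 then 1 else 0
  rw [anf_apply, sum_eq_single S] at h
  · rw [prod_congr rfl (g := fun _ => 1) (by intro i hi; simp [hi])] at h
    simp at h hS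
    exact hS h
  · intro T _ hTS
    by_cases hT : c T = 0
    · simp [hT]
    · have hc := hmin T (by simp [hT])
      have : ¬ T.1 ⊆ S.1 := fun hs => hTS (Subtype.ext (eq_of_subset_of_card_le hs hc))
      obtain ⟨i, hi, hiS⟩ := not_subset.mp this
      rw [prod_eq_zero hi (by simp [hiS]), mul_zero]
  · simp

lemma range_anf (m r : ℕ) : LinearMap.range (anf m r) = rmSubmodule m r := by
  apply le_antisymm
  · rintro _ ⟨c, rfl⟩
    have : anf m r c = ∑ S, c S • fun x : Cube m => ∏ i ∈ S.1, x i := by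
      ext x; simp [anf_apply]
    rw [this]
    exact Submodule.sum_mem _ fun S _ => Submodule.smul_mem _ _
      (prod_linear_mem_RM LinearMap.id S.1 S.2)
  · rintro f ⟨p, hp, hf⟩
    have hf' : f = ∑ d ∈ p.support, p.coeff d • fun x : Cube m => ∏ i ∈ d.support, x i := by
      ext x
      rw [← hf, MvPolynomial.eval_eq]
      simp only [Finset.sum_apply, Pi.smul_apply, smul_eq_mul]
      refine sum_congr rfl fun d _ => ?_
      congr 1
      refine prod_congr rfl fun i hi => ?_
      have h2 : ∀ a : ZMod 2, a = 0 ∨ a = 1 := by decide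
      rcases h2 (x i) with h | h <;> simp [h, Finsupp.mem_support_iff.mp hi]
    rw [hf']
    refine Submodule.sum_mem _ fun d hd => Submodule.smul_mem _ _ ?_
    have hcard : d.support.card ≤ r := by
      refine le_trans ?_ ((MvPolynomial.le_totalDegree hd).trans hp)
      rw [card_eq_sum_ones]
      exact sum_le_sum fun i hi => Nat.one_le_iff_ne_zero.mpr (Finsupp.mem_support_iff.mp hi)
    refine ⟨Pi.single ⟨d.support, hcard⟩ 1, ?_⟩
    ext x
    rw [anf_apply, sum_eq_single ⟨d.support, hcard⟩]
    · simp
    · intro T _ hT; simp [Pi.single_eq_of_ne hT]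
    · simp

lemma card_finset_card_le (m r : ℕ) :
    Fintype.card {S : Finset (Fin m) // S.card ≤ r} = binomLe m r := by
  rw [Fintype.card_subtype, binomLe,
    card_eq_sum_card_fiberwise (f := Finset.card) (t := range (r + 1))
      (by intro S hS; simpa [Nat.lt_succ_iff] using hS)]
  refine sum_congr rfl fun i hi => ?_
  have : (univ.filter fun S : Finset (Fin m) => S.card ≤ r).filter (fun S => S.card = i)
      = powersetCard i univ := by
    ext S
    simp only [mem_filter, mem_univ, true_and, mem_powersetCard, subset_univ, mem_range] at hi ⊢
    omega
  rw [this, card_powersetCard, card_univ, Fintype.card_fin]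

lemma card_rmSubmodule (m r : ℕ) : Nat.card (rmSubmodule m r) = 2 ^ binomLe m r := by
  rw [← range_anf, ← Nat.card_congr (LinearEquiv.ofInjective _ (anf_injective m r)).toEquiv,
    Nat.card_eq_fintype_card, Fintype.card_fun, ZMod.card, card_finset_card_le]

lemma ncard_RM (m r : ℕ) : (RM m r).ncard = 2 ^ binomLe m r := by
  rw [← card_rmSubmodule]; rfl

/-- The discrete derivative of `f` in direction `y`. -/
def discreteDeriv {m : ℕ} (y : Cube m) (f : BF m) : BF m := fun x => f x + f (x + y)

lemma discreteDeriv_mem_RM {m r : ℕ} (y : Cube m) {f : BF m} (hf : f ∈ RM m r) :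
    discreteDeriv y f ∈ RM m (r - 1) := by
  rw [← mem_rmSubmodule, ← range_anf] at hf
  obtain ⟨c, rfl⟩ := hf
  have h : discreteDeriv y (anf m r c) = ∑ S, c S • ∑ T ∈ S.1.ssubsets,
      (∏ i ∈ S.1 \ T, y i) • fun x : Cube m => ∏ i ∈ T, x i := by
    ext x
    simp only [discreteDeriv, anf_apply, ← sum_add_distrib, Finset.sum_apply, Pi.smul_apply,
      smul_eq_mul, Pi.add_apply]
    refine sum_congr rfl fun S _ => ?_
    rw [prod_add, ← sum_erase_add _ _ (mem_powerset_self S.1), ← mul_add]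
    congr 1
    rw [sdiff_self, bot_eq_empty, prod_empty, mul_one, add_comm, add_assoc, CharTwo.add_self_eq_zero, add_zero]
    exact sum_congr rfl fun T _ => mul_comm _ _
  rw [h, ← mem_rmSubmodule]
  refine Submodule.sum_mem _ fun S _ => Submodule.smul_mem _ _ <|
    Submodule.sum_mem _ fun T hT => Submodule.smul_mem _ _ ?_
  have := card_lt_card (mem_ssubsets.mp hT)
  exact prod_linear_mem_RM LinearMap.id T (by have := S.2; omega)

lemma zmod_two_eq_one_iff {a : ZMod 2} : a = 1 ↔ a ≠ 0 := by revert a; decide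

lemma wt_mul_two_pow {m : ℕ} (f : BF m) :
    wt f * 2 ^ m = ((univ.filter fun x => f x = 1).card : ℝ) := by
  rw [wt]; field_simp

lemma card_cube (m : ℕ) : Fintype.card (Cube m) = 2 ^ m := by
  simp [ZMod.card]

lemma wt_nonneg {m : ℕ} (f : BF m) : 0 ≤ wt f := by unfold wt; positivity

lemma wt_le_one {m : ℕ} (f : BF m) : wt f ≤ 1 := by
  rw [wt, div_le_one (by positivity)]
  calc ((univ.filter fun x => f x = 1).card : ℝ) ≤ (univ : Finset (Cube m)).card := by
        exact_mod_cast card_le_card (filter_subset _ _)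
    _ = 2 ^ m := by rw [card_univ, card_cube]; norm_cast

lemma wt_add_le {m : ℕ} (f g : BF m) : wt (f + g) ≤ wt f + wt g := by
  rw [wt, wt, wt, ← add_div]
  gcongr
  norm_cast
  refine (card_le_card ?_).trans (card_union_le _ _)
  intro x
  simp only [mem_filter, mem_univ, true_and, mem_union, Pi.add_apply]
  generalize f x = a
  generalize g x = b
  revert a b; decide

lemma wt_translate {m : ℕ} (y : Cube m) (f : BF m) : wt (fun x => f (x + y)) = wt f := by
  rw [wt, wt]
  congr 2
  refine card_bij (fun x _ => x + y) ?_ ?_ ?_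
  · intro x; simp
  · intro a _ b _ h; exact add_right_cancel h
  · intro b hb; exact ⟨b - y, by simpa using hb, by simp⟩

lemma wt_discreteDeriv_le {m : ℕ} (y : Cube m) (f : BF m) :
    wt (discreteDeriv y f) ≤ 2 * wt f := by
  have := wt_add_le f (fun x => f (x + y))
  rw [wt_translate] at this
  linarith [show wt (discreteDeriv y f) = wt (f + fun x => f (x + y)) from rfl]

lemma wt_const_one (m : ℕ) : wt (fun _ : Cube m => (1 : ZMod 2)) = 1 := by
  simp [wt]

/-- The minimum distance of the Reed–Muller code. -/
lemma eq_zero_of_wt_lt {m r : ℕ} {f : BF m} (hf : f ∈ RM m r) (h : wt f < (1 / 2) ^ r) :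
    f = 0 := by
  induction r generalizing f with
  | zero =>
    have hc : ∀ y, f y = f 0 := by
      obtain ⟨p, hp, hpf⟩ := hf
      rw [Nat.le_zero, MvPolynomial.totalDegree_eq_zero_iff_eq_C] at hp
      intro y
      rw [← hpf, ← hpf, hp]; simp
    by_contra hne
    have h1 : f = fun _ => 1 := by
      ext y
      rw [hc y, zmod_two_eq_one_iff]
      exact fun h0 => hne (funext fun y => by rw [hc y, h0]; rfl)
    rw [h1, wt_const_one] at h
    norm_num at h
  | succ r ih =>
    have hd : ∀ y, discreteDeriv y f = 0 := fun y =>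
      ih (discreteDeriv_mem_RM y hf) (by
        have := wt_discreteDeriv_le y f
        rw [pow_succ] at h; linarith)
    have hc : ∀ y, f y = f 0 := by
      intro y
      have := congr_fun (hd y) 0
      simp only [discreteDeriv, zero_add, Pi.zero_apply] at this
      rw [← sub_eq_zero, CharTwo.sub_eq_add, add_comm, this]
    by_contra hne
    have h1 : f = fun _ => 1 := by
      ext y
      rw [hc y, zmod_two_eq_one_iff]
      exact fun h0 => hne (funext fun y => by rw [hc y, h0]; rfl)
    rw [h1, wt_const_one] at h
    exact absurd h (not_lt.mpr (pow_le_one₀ (by norm_num) (by norm_num)))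

/-- The codewords of `RM m r` invariant under the translations by the elements of `y`. -/
def invariantCode {m t : ℕ} (r : ℕ) (y : Fin t → Cube m) : Submodule (ZMod 2) (BF m) where
  carrier := {f | f ∈ RM m r ∧ ∀ i x, f (x + y i) = f x}
  zero_mem' := ⟨RM_zero_mem m r, by simp⟩
  add_mem' := fun hf hg => ⟨(rmSubmodule m r).add_mem hf.1 hg.1, fun i x => by
    simp [hf.2 i x, hg.2 i x]⟩
  smul_mem' := fun c f hf => ⟨(rmSubmodule m r).smul_mem c hf.1, fun i x => by
    simp [hf.2 i x]⟩

lemma exists_surjective_vanishing {m t : ℕ} (y : Fin t → Cube m) :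
    ∃ L : Cube m →ₗ[ZMod 2] Cube (m - t), Function.Surjective L ∧ ∀ i, L (y i) = 0 := by
  set V := Submodule.span (ZMod 2) (Set.range y)
  have hV : Module.finrank (ZMod 2) V ≤ t := by
    exact (finrank_range_le_card (R := ZMod 2) y).trans (Fintype.card_fin t).le
  have hQ : m - t ≤ Module.finrank (ZMod 2) (Cube m ⧸ V) := by
    have := V.finrank_quotient_add_finrank
    simp only [Module.finrank_fin_fun] at this
    omega
  let e := (Module.finBasis (ZMod 2) (Cube m ⧸ V)).equivFun
  refine ⟨LinearMap.funLeft (ZMod 2) (ZMod 2) (Fin.castLE hQ) ∘ₗ e.toLinearMap ∘ₗ V.mkQ, ?_, ?_⟩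
  · exact (LinearMap.funLeft_surjective_of_injective (ZMod 2) (ZMod 2) _ (Fin.castLE_injective hQ)).comp
      (e.surjective.comp V.mkQ_surjective)
  · intro i
    have : V.mkQ (y i) = 0 := by
      simpa using Submodule.subset_span (Set.mem_range_self i)
    simp [this]

lemma two_pow_le_card_invariantCode {m t : ℕ} (r : ℕ) (y : Fin t → Cube m) :
    2 ^ binomLe (m - t) r ≤ Nat.card (invariantCode r y) := by
  obtain ⟨L, hL, hLy⟩ := exists_surjective_vanishing y
  rw [← card_rmSubmodule]
  have hmem : ∀ f ∈ rmSubmodule (m - t) r, f ∘ L ∈ invariantCode r y := by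
    intro f hf
    refine ⟨?_, fun i x => by simp [hLy]⟩
    rw [← range_anf] at hf
    obtain ⟨c, rfl⟩ := hf
    have : anf (m - t) r c ∘ L = ∑ S, c S • fun x : Cube m => ∏ i ∈ S.1, L x i := by
      ext x; simp [anf_apply]
    rw [this, ← mem_rmSubmodule]
    exact Submodule.sum_mem _ fun S _ => Submodule.smul_mem _ _ (prod_linear_mem_RM L S.1 S.2)
  refine Nat.card_le_card_of_injective (fun f => ⟨f.1 ∘ L, hmem f.1 f.2⟩) ?_
  intro f g hfg
  exact Subtype.ext (hL.injective_comp_right (Subtype.ext_iff.mp hfg))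

lemma W_eq_card (m r : ℕ) (β : ℝ) :
    W m r β = (univ.filter fun f : BF m => f ∈ RM m r ∧ wt f ≤ β).card := by
  rw [W, ← Set.ncard_coe_finset]; simp

lemma W_mono {m r : ℕ} {a b : ℝ} (h : a ≤ b) : W m r a ≤ W m r b := by
  rw [W_eq_card, W_eq_card]
  refine card_le_card fun f => ?_
  simp only [mem_filter, mem_univ, true_and]
  exact fun hf => ⟨hf.1, hf.2.trans h⟩

lemma W_le_two_pow (m r : ℕ) (β : ℝ) : W m r β ≤ 2 ^ binomLe m r := by
  rw [← ncard_RM]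
  exact Set.ncard_le_ncard (fun f hf => hf.1) (Set.toFinite _)

lemma W_le_one_of_lt {m r : ℕ} {β : ℝ} (h : β < (1 / 2) ^ r) : W m r β ≤ 1 := by
  rw [W_eq_card, card_le_one]
  intro f hf g hg
  simp only [mem_filter, mem_univ, true_and] at hf hg
  rw [eq_zero_of_wt_lt hf.1 (hf.2.trans_lt h), eq_zero_of_wt_lt hg.1 (hg.2.trans_lt h)]

/-- If every codeword of weight at most `β` is `η`-close to an element of `Φ`, then there are at
most `Φ.card * W m r (2 * η)` such codewords. -/
lemma W_le_card_mul {m r : ℕ} {β η : ℝ} (Φ : Finset (BF m))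
    (h : ∀ f ∈ RM m r, wt f ≤ β → ∃ φ ∈ Φ, wt (φ + f) ≤ η) :
    W m r β ≤ Φ.card * W m r (2 * η) := by
  have h' : ∀ f : BF m, ∃ φ, f ∈ RM m r ∧ wt f ≤ β → φ ∈ Φ ∧ wt (φ + f) ≤ η := by
    intro f
    by_cases hf : f ∈ RM m r ∧ wt f ≤ β
    · obtain ⟨φ, hφ⟩ := h f hf.1 hf.2
      exact ⟨φ, fun _ => hφ⟩
    · exact ⟨0, fun h => absurd h hf⟩
  choose F hF using h'
  rw [W_eq_card, mul_comm]
  refine card_le_mul_card_image_of_maps_to (f := F) ?_ _ ?_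
  · intro f hf
    exact (hF f (by simpa using hf)).1
  · intro φ _
    rcases (filter (fun a => F a = φ) (univ.filter fun f : BF m =>
      f ∈ RM m r ∧ wt f ≤ β)).eq_empty_or_nonempty with he | ⟨g, hg⟩
    · rw [he]; simp
    · rw [W_eq_card]
      simp only [mem_filter, mem_univ, true_and] at hg
      refine card_le_card_of_injOn (fun f => f + g) ?_ ?_
      · intro f hf
        simp only [coe_filter, mem_filter, mem_univ, true_and, Set.mem_ofPred_eq] at hf ⊢
        refine ⟨(rmSubmodule m r).add_mem hf.1.1 hg.1.1, ?_⟩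
        have h1 := (hF f hf.1).2
        have h2 := (hF g hg.1).2
        rw [hf.2] at h1
        rw [hg.2] at h2
        have h3 := wt_add_le (φ + f) (φ + g)
        have h4 : φ + f + (φ + g) = f + g := by
          ext x
          simp only [Pi.add_apply]
          generalize φ x = a
          generalize f x = b
          generalize g x = c
          revert a b c; decide
        rw [h4] at h3
        linarith
      · intro a _ b _ hab
        exact add_right_cancel hab

/-- Averaging over the directions, the `k`-th order derivatives of a codeword of small weight
agree with the codeword at each point with high probability. -/
lemma exists_derivative_family {m r : ℕ} {f : BF m} (hf : f ∈ RM m r) (k : ℕ) :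
    ∃ (ι : Type) (_ : Fintype ι) (_ : Nonempty ι) (h : ι → BF m),
      (∀ i, h i ∈ RM m (r - k)) ∧ (∀ i, wt (h i) ≤ 2 ^ k * wt f) ∧
      ∀ x, ((univ.filter fun i => h i x ≠ f x).card : ℝ) ≤
        (2 ^ k - 1) * wt f * Fintype.card ι := by
  induction k with
  | zero => exact ⟨Unit, inferInstance, inferInstance, fun _ => f, by simpa using hf, by simp,
      by simp⟩
  | succ k ih =>
    obtain ⟨ι, _, _, h, h1, h2, h3⟩ := ih
    refine ⟨ι × Cube m, inferInstance, inferInstance, fun p => discreteDeriv p.2 (h p.1),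
      fun p => ?_, fun p => ?_, fun x => ?_⟩
    · rw [← Nat.sub_sub]
      exact discreteDeriv_mem_RM _ (h1 _)
    · rw [pow_succ']
      linarith [wt_discreteDeriv_le p.2 (h p.1), h2 p.1]
    · have hsub : (univ.filter fun p : ι × Cube m => discreteDeriv p.2 (h p.1) x ≠ f x) ⊆
          (univ.filter fun i => h i x ≠ f x) ×ˢ univ ∪
            univ.filter fun p : ι × Cube m => h p.1 (x + p.2) = 1 := by
        intro p
        simp only [mem_filter, mem_univ, true_and, mem_union, mem_product, and_true]
        simp only [discreteDeriv]
        generalize h p.1 x = a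
        generalize h p.1 (x + p.2) = b
        generalize f x = c
        revert a b c; decide
      have hsecond : ((univ.filter fun p : ι × Cube m => h p.1 (x + p.2) = 1).card : ℝ) =
          ∑ i, wt (h i) * 2 ^ m := by
        rw [card_filter, ← univ_product_univ, sum_product]
        push_cast
        refine sum_congr rfl fun i _ => ?_
        rw [← wt_translate x, wt_mul_two_pow, card_filter]
        push_cast
        simp only [add_comm]
      calc ((univ.filter fun p : ι × Cube m => discreteDeriv p.2 (h p.1) x ≠ f x).card : ℝ)
          ≤ ((univ.filter fun i => h i x ≠ f x).card : ℝ) * 2 ^ m + ∑ i, wt (h i) * 2 ^ m := by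
            rw [← hsecond]
            refine (Nat.cast_le.mpr ((card_le_card hsub).trans (card_union_le _ _))).trans ?_
            rw [card_product, card_univ, card_cube]
            push_cast; rfl
        _ ≤ ((2 ^ k - 1) * wt f * Fintype.card ι) * 2 ^ m +
              ∑ _i : ι, (2 ^ k * wt f) * 2 ^ m := by
            gcongr with i
            · exact h3 x
            · exact h2 i
        _ = _ := by
            rw [sum_const, card_univ, Fintype.card_prod, card_cube, nsmul_eq_mul]
            push_cast; ring

lemma exists_mul_close {m r : ℕ} {f : BF m} (hf : f ∈ RM m r) (k : ℕ) :
    ∃ g ∈ RM m (r - k), ∃ h ∈ RM m (r - k), wt (g * h + f) ≤ (4 ^ k - 1) * wt f ^ 2 := by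
  obtain ⟨ι, _, _, h, h1, -, h3⟩ := exists_derivative_family hf k
  set q := (2 ^ k - 1) * wt f with hq
  set n := (Fintype.card ι : ℝ) with hn
  have hq0 : 0 ≤ q := mul_nonneg (by linarith [one_le_pow₀ (M₀ := ℝ) one_le_two (n := k)])
    (wt_nonneg f)
  set E : Cube m → ℝ := fun x => ((univ.filter fun i => h i x ≠ f x).card : ℝ) with hE
  have hE0 : ∀ x, 0 ≤ E x := fun x => by positivity
  have hpoint : ∀ x, ((univ.filter fun p : ι × ι => (h p.1 * h p.2 + f) x = 1).card : ℝ) ≤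
      (if f x = 1 then 2 * q * n ^ 2 else 0) + q ^ 2 * n ^ 2 := by
    intro x
    by_cases hx : f x = 1
    · have hsub : (univ.filter fun p : ι × ι => (h p.1 * h p.2 + f) x = 1) ⊆
          (univ.filter fun i => h i x ≠ f x) ×ˢ univ ∪
            univ ×ˢ (univ.filter fun i => h i x ≠ f x) := by
        intro p
        simp only [Pi.add_apply, Pi.mul_apply, hx, mem_filter, mem_univ, true_and, mem_union,
          mem_product, and_true]
        generalize h p.1 x = a
        generalize h p.2 x = b
        revert a b; decide
      have hc : ((univ.filter fun p : ι × ι => (h p.1 * h p.2 + f) x = 1).card : ℝ) ≤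
          E x * n + n * E x := by
        refine (Nat.cast_le.mpr ((card_le_card hsub).trans (card_union_le _ _))).trans ?_
        rw [card_product, card_product, card_univ]
        push_cast; rfl
      rw [if_pos hx]
      nlinarith [h3 x, sq_nonneg (q * n), mul_le_mul_of_nonneg_right (h3 x)
        (show 0 ≤ n by positivity)]
    · have hsub : (univ.filter fun p : ι × ι => (h p.1 * h p.2 + f) x = 1) ⊆
          (univ.filter fun i => h i x ≠ f x) ×ˢ (univ.filter fun i => h i x ≠ f x) := by
        intro p
        simp only [Pi.add_apply, Pi.mul_apply, mem_filter, mem_univ, true_and, mem_product]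
        revert hx
        generalize h p.1 x = a
        generalize h p.2 x = b
        generalize f x = c
        revert a b c; decide
      have hc : ((univ.filter fun p : ι × ι => (h p.1 * h p.2 + f) x = 1).card : ℝ) ≤
          E x * E x := by
        refine (Nat.cast_le.mpr (card_le_card hsub)).trans ?_
        rw [card_product]
        push_cast; rfl
      rw [if_neg hx]
      have := mul_le_mul (h3 x) (h3 x) (hE0 x) (by positivity)
      linarith
  have hsum : ∑ p : ι × ι, wt (h p.1 * h p.2 + f) ≤
      ∑ _p : ι × ι, (4 ^ k - 1) * wt f ^ 2 := by
    have h2m : (0 : ℝ) < 2 ^ m := by positivity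
    rw [← mul_le_mul_iff_left₀ h2m]
    calc (∑ p : ι × ι, wt (h p.1 * h p.2 + f)) * 2 ^ m
        = ∑ x, ((univ.filter fun p : ι × ι => (h p.1 * h p.2 + f) x = 1).card : ℝ) := by
          simp_rw [sum_mul, wt_mul_two_pow, card_filter]
          push_cast
          exact sum_comm
      _ ≤ ∑ x, ((if f x = 1 then 2 * q * n ^ 2 else 0) + q ^ 2 * n ^ 2) :=
          sum_le_sum fun x _ => hpoint x
      _ = (wt f * 2 ^ m) * (2 * q * n ^ 2) + 2 ^ m * (q ^ 2 * n ^ 2) := by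
          rw [sum_add_distrib, ← sum_filter, sum_const, sum_const, card_univ, card_cube,
            wt_mul_two_pow]
          simp
      _ = _ := by
          rw [sum_const, card_univ, Fintype.card_prod, hq, nsmul_eq_mul]
          have : (4 : ℝ) ^ k = 2 ^ k * 2 ^ k := by rw [← mul_pow]; norm_num
          rw [this]
          push_cast; ring
  obtain ⟨p, -, hp⟩ := exists_le_of_sum_le univ_nonempty hsum
  exact ⟨_, h1 p.1, _, h1 p.2, hp⟩

lemma W_le_of_derivatives {m r : ℕ} {β β' : ℝ} (k : ℕ) (h : 2 * ((4 ^ k - 1) * β ^ 2) ≤ β') :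
    W m r β ≤ 2 ^ (2 * binomLe m (r - k)) * W m r β' := by
  set Φ : Finset (BF m) := image₂ (fun g h => g * h) (univ.filter fun g => g ∈ RM m (r - k))
    (univ.filter fun g => g ∈ RM m (r - k)) with hΦ
  have hcard : Φ.card ≤ 2 ^ (2 * binomLe m (r - k)) := by
    refine (card_image₂_le _ _ _).trans ?_
    have : (univ.filter fun g => g ∈ RM m (r - k)).card = 2 ^ binomLe m (r - k) := by
      rw [← ncard_RM, ← Set.ncard_coe_finset]; simp
    rw [this, ← pow_add, two_mul]
  refine (W_le_card_mul (η := (4 ^ k - 1) * β ^ 2) Φ fun f hf hβ => ?_).trans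
    (Nat.mul_le_mul hcard (W_mono h))
  obtain ⟨g, hg, h, hh, hw⟩ := exists_mul_close hf k
  refine ⟨g * h, mem_image₂_of_mem (by simpa using hg) (by simpa using hh), hw.trans ?_⟩
  have : (0 : ℝ) ≤ 4 ^ k - 1 := by linarith [one_le_pow₀ (M₀ := ℝ) (a := 4) (by norm_num) (n := k)]
  have := wt_nonneg f
  gcongr

/-- The sign function `(-1)^a` on `ZMod 2`. -/
noncomputable def zmodSign (a : ZMod 2) : ℝ := if a = 0 then 1 else -1

lemma zmodSign_add (a b : ZMod 2) : zmodSign (a + b) = zmodSign a * zmodSign b := by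
  have : ∀ a : ZMod 2, a = 0 ∨ a = 1 := by decide
  have h11 : (1 + 1 : ZMod 2) = 0 := by decide
  rcases this a with rfl | rfl <;> rcases this b with rfl | rfl <;> simp [zmodSign, h11]

lemma zmodSign_mul_self (a : ZMod 2) : zmodSign a * zmodSign a = 1 := by
  unfold zmodSign; split_ifs <;> norm_num

lemma sum_zmodSign {m : ℕ} (f : BF m) :
    ∑ x, zmodSign (f x) = (1 - 2 * wt f) * 2 ^ m := by
  have h : ∀ x, zmodSign (f x) = 1 - 2 * (if f x = 1 then 1 else 0) := by
    intro x
    by_cases hx : f x = 0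
    · simp [zmodSign, hx]
    · have h1 := zmod_two_eq_one_iff.mpr hx
      simp [zmodSign, h1]
      norm_num
  simp_rw [h]
  rw [sum_sub_distrib, ← mul_sum, sub_mul, mul_assoc, wt_mul_two_pow, card_filter]
  simp

/-- The average of `G` over the translations by the subset sums of `y`. -/
noncomputable def spanAvg {m : ℕ} : (t : ℕ) → (Fin t → Cube m) → (Cube m → ℝ) → Cube m → ℝ
  | 0, _, G => G
  | t + 1, y, G => fun x =>
      (spanAvg t (Fin.tail y) G x + spanAvg t (Fin.tail y) G (x + y 0)) / 2

lemma spanAvg_mul_of_invariant {m : ℕ} (t : ℕ) (y : Fin t → Cube m) (G H : Cube m → ℝ)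
    (hH : ∀ i x, H (x + y i) = H x) (x : Cube m) :
    spanAvg t y (fun x => G x * H x) x = spanAvg t y G x * H x := by
  induction t generalizing x with
  | zero => rfl
  | succ t ih =>
    simp only [spanAvg]
    rw [ih (Fin.tail y) (fun i x => hH i.succ x), ih (Fin.tail y) (fun i x => hH i.succ x),
      hH 0 x]
    ring

/-- Averaging over a random direction halves the variance. -/
lemma exists_sum_sq_avg_le {m : ℕ} (g : Cube m → ℝ) (hg : ∑ x, g x = 0) :
    ∃ y : Cube m, ∑ x, ((g x + g (x + y)) / 2) ^ 2 ≤ (∑ x, g x ^ 2) / 2 := by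
  have hshift : ∀ y, ∑ x, g (x + y) ^ 2 = ∑ x, g x ^ 2 := fun y =>
    Fintype.sum_equiv (Equiv.addRight y) _ _ fun x => rfl
  have hshift' : ∀ x, ∑ y, g (x + y) = 0 := fun x => by
    rw [← hg]; exact Fintype.sum_equiv (Equiv.addLeft x) _ _ fun x => rfl
  have hcross : ∑ y, ∑ x, g x * g (x + y) = 0 := by
    rw [sum_comm]
    simp_rw [← mul_sum, hshift', mul_zero, sum_const_zero]
  have hexp : ∀ y, ∑ x, ((g x + g (x + y)) / 2) ^ 2 =
      (∑ x, g x ^ 2) / 2 + (∑ x, g x * g (x + y)) / 2 := by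
    intro y
    have : ∀ x, ((g x + g (x + y)) / 2) ^ 2 =
        (g x ^ 2) / 4 + g (x + y) ^ 2 / 4 + g x * g (x + y) / 2 := fun x => by ring
    simp_rw [this, sum_add_distrib, ← sum_div, hshift]
    ring
  obtain ⟨y, -, hy⟩ := exists_le_of_sum_le (s := univ)
    (f := fun y : Cube m => ∑ x, ((g x + g (x + y)) / 2) ^ 2)
    (g := fun _ => (∑ x, g x ^ 2) / 2) univ_nonempty (by
      simp_rw [hexp, sum_add_distrib, ← sum_div, hcross]
      simp)
  exact ⟨y, hy⟩

lemma exists_sum_sq_spanAvg_le {m : ℕ} (t : ℕ) (G : Cube m → ℝ) (μ : ℝ)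
    (hG : ∑ x, G x = μ * 2 ^ m) :
    ∃ y : Fin t → Cube m, ∑ x, spanAvg t y G x = μ * 2 ^ m ∧
      ∑ x, (spanAvg t y G x - μ) ^ 2 ≤ (∑ x, (G x - μ) ^ 2) / 2 ^ t := by
  induction t with
  | zero => exact ⟨Fin.elim0, hG, by simp [spanAvg]⟩
  | succ t ih =>
    obtain ⟨y, hy, hle⟩ := ih
    obtain ⟨z, hz⟩ := exists_sum_sq_avg_le (fun x => spanAvg t y G x - μ) (by
      rw [sum_sub_distrib, hy]; simp; ring)
    refine ⟨Fin.cons z y, ?_, ?_⟩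
    · have hs : ∑ x, spanAvg t y G (x + z) = ∑ x, spanAvg t y G x :=
        Fintype.sum_equiv (Equiv.addRight z) _ _ fun x => rfl
      simp only [spanAvg, Fin.tail_cons, Fin.cons_zero]
      rw [← sum_div, sum_add_distrib, hs, hy]; ring
    · simp only [spanAvg, Fin.tail_cons, Fin.cons_zero]
      calc _ = ∑ x, ((spanAvg t y G x - μ + (spanAvg t y G (x + z) - μ)) / 2) ^ 2 :=
            sum_congr rfl fun x _ => by ring
        _ ≤ _ := hz
        _ ≤ (∑ x, (G x - μ) ^ 2) / 2 ^ t / 2 := by gcongr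
        _ = _ := by rw [pow_succ, div_div]

/-- The prediction of `f x` from the derivatives of `f` at `x` in the directions spanned by `y`. -/
noncomputable def predictor {m t : ℕ} (y : Fin t → Cube m) (f : BF m) : BF m := fun x =>
  if 0 < zmodSign (f x) * spanAvg t y (fun x => zmodSign (f x)) x then 0 else 1

lemma predictor_add_of_invariant {m t r : ℕ} (y : Fin t → Cube m) (f : BF m) {h : BF m}
    (hh : h ∈ invariantCode r y) : predictor y (f + h) = predictor y f := by
  ext x
  unfold predictor
  have := spanAvg_mul_of_invariant t y (fun x => zmodSign (f x)) (fun x => zmodSign (h x))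
    (fun i x => by rw [hh.2 i x]) x
  simp only [Pi.add_apply, zmodSign_add]
  rw [this, show ∀ a b c : ℝ, a * b * (c * b) = a * c * (b * b) by intros; ring,
    zmodSign_mul_self, mul_one]

lemma exists_predictor_close {m : ℕ} (t : ℕ) (f : BF m) {β : ℝ} (hβ : β < 1 / 2)
    (hf : wt f ≤ β) :
    ∃ y : Fin t → Cube m,
      wt (predictor y f + f) ≤ (1 - (1 - 2 * β) ^ 2) / (1 - 2 * β) ^ 2 / 2 ^ t := by
  set μ := 1 - 2 * wt f with hμ
  have hμ0 : 0 < μ := by linarith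
  obtain ⟨y, -, hy⟩ := exists_sum_sq_spanAvg_le t (fun x => zmodSign (f x)) μ (sum_zmodSign f)
  refine ⟨y, ?_⟩
  have hvar : ∑ x, (zmodSign (f x) - μ) ^ 2 = (1 - μ ^ 2) * 2 ^ m := by
    have : ∀ x, (zmodSign (f x) - μ) ^ 2 = 1 + μ ^ 2 - 2 * μ * zmodSign (f x) := fun x => by
      linear_combination zmodSign_mul_self (f x)
    simp_rw [this]
    rw [sum_sub_distrib, ← mul_sum, sum_zmodSign]
    simp; ring
  rw [hvar] at hy
  have hpoint : ∀ x, (if (predictor y f + f) x = 1 then μ ^ 2 else 0) ≤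
      (spanAvg t y (fun x => zmodSign (f x)) x - μ) ^ 2 := by
    intro x
    split_ifs with hx
    · have hle : spanAvg t y (fun x => zmodSign (f x)) x ≤ 0 := by
        by_contra hpos
        push Not at hpos
        revert hx
        simp only [Pi.add_apply, predictor]
        by_cases h0 : f x = 0
        · have : zmodSign (f x) = 1 := by simp [zmodSign, h0]
          rw [this, if_pos (by linarith)]
          simp [h0]
        · have h1 := zmod_two_eq_one_iff.mpr h0
          have : zmodSign (f x) = -1 := by simp [zmodSign, h1]
          rw [this, if_neg (by linarith)]
          simp [h1]
      nlinarith
    · positivity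
  have hcount : wt (predictor y f + f) * 2 ^ m * μ ^ 2 ≤ (1 - μ ^ 2) * 2 ^ m / 2 ^ t := by
    refine le_trans ?_ hy
    rw [wt_mul_two_pow, ← nsmul_eq_mul, ← sum_const, sum_filter]
    exact sum_le_sum fun x _ => hpoint x
  have h1 : wt (predictor y f + f) ≤ (1 - μ ^ 2) / μ ^ 2 / 2 ^ t := by
    have h2m : (0 : ℝ) < 2 ^ m := by positivity
    rw [div_div, le_div_iff₀ (by positivity), ← mul_le_mul_iff_left₀ h2m]
    rw [le_div_iff₀ (by positivity)] at hcount
    linarith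
  refine h1.trans ?_
  have hε : 0 < 1 - 2 * β := by linarith
  have hεμ : 1 - 2 * β ≤ μ := by linarith
  gcongr ?_ / _
  rw [sub_div, sub_div, div_self (by positivity), div_self (by positivity)]
  gcongr

lemma card_image_predictor_mul_le {m t : ℕ} (r : ℕ) (y : Fin t → Cube m) :
    ((univ.filter fun f => f ∈ RM m r).image (predictor y)).card * 2 ^ binomLe (m - t) r ≤
      2 ^ binomLe m r := by
  have hRM : (univ.filter fun f => f ∈ RM m r).card = 2 ^ binomLe m r := by
    rw [← ncard_RM, ← Set.ncard_coe_finset]; simp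
  rw [← hRM, card_eq_sum_card_image (predictor y) (univ.filter fun f => f ∈ RM m r),
    ← smul_eq_mul]
  refine card_nsmul_le_sum _ _ _ fun φ hφ => ?_
  obtain ⟨f, hf, rfl⟩ := mem_image.mp hφ
  refine (two_pow_le_card_invariantCode r y).trans ?_
  rw [Nat.card_eq_fintype_card, ← card_univ]
  refine card_le_card_of_injOn (fun h => f + h.1) ?_ ?_
  · intro h _
    simp only [mem_filter, mem_univ, true_and, coe_filter, Set.mem_ofPred_eq] at hf ⊢
    exact ⟨(rmSubmodule m r).add_mem hf h.2.1, predictor_add_of_invariant y f h.2⟩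
  · intro a _ b _ hab
    exact Subtype.ext (add_left_cancel hab)

lemma W_le_of_spanAvg {m r : ℕ} {β β' : ℝ} (t : ℕ) (hβ : β < 1 / 2)
    (h : 2 * ((1 - (1 - 2 * β) ^ 2) / (1 - 2 * β) ^ 2 / 2 ^ t) ≤ β') :
    W m r β * 2 ^ binomLe (m - t) r ≤ 2 ^ (t * m) * 2 ^ binomLe m r * W m r β' := by
  set Φ : Finset (BF m) := univ.biUnion fun y : Fin t → Cube m =>
    (univ.filter fun f => f ∈ RM m r).image (predictor y) with hΦ
  have hcard : Φ.card * 2 ^ binomLe (m - t) r ≤ 2 ^ (t * m) * 2 ^ binomLe m r := by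
    calc Φ.card * 2 ^ binomLe (m - t) r
        ≤ (∑ y : Fin t → Cube m, ((univ.filter fun f => f ∈ RM m r).image (predictor y)).card) *
            2 ^ binomLe (m - t) r := Nat.mul_le_mul_right _ card_biUnion_le
      _ ≤ ∑ _y : Fin t → Cube m, 2 ^ binomLe m r := by
          rw [sum_mul]
          exact sum_le_sum fun y _ => card_image_predictor_mul_le r y
      _ = _ := by
          rw [sum_const, card_univ, Fintype.card_fun, card_cube, Fintype.card_fin, ← pow_mul,
            smul_eq_mul, mul_comm m t]
  have hW := (W_le_card_mul (m := m) (r := r) (β := β) Φ fun f hf hwt => ?_).trans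
    (Nat.mul_le_mul_left _ (W_mono h))
  · calc W m r β * 2 ^ binomLe (m - t) r
        ≤ Φ.card * W m r β' * 2 ^ binomLe (m - t) r := Nat.mul_le_mul_right _ hW
      _ = Φ.card * 2 ^ binomLe (m - t) r * W m r β' := by ring
      _ ≤ _ := Nat.mul_le_mul_right _ hcard
  · obtain ⟨y, hy⟩ := exists_predictor_close t f hβ hwt
    exact ⟨_, mem_biUnion.mpr ⟨y, mem_univ _, mem_image_of_mem _ (by simpa using hf)⟩, hy⟩

lemma choose_mul_pow_le {N z : ℕ} (h : z ≤ N) (u : ℕ) :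
    z.choose u * N ^ u ≤ z ^ u * N.choose u := by
  have key : z.descFactorial u * N ^ u ≤ z ^ u * N.descFactorial u := by
    induction u with
    | zero => simp
    | succ u ih =>
      have h1 : (z - u) * N ≤ z * (N - u) := by
        rw [Nat.sub_mul, Nat.mul_sub]
        have := Nat.mul_le_mul_right u h
        rw [Nat.mul_comm N u] at this
        omega
      calc z.descFactorial (u + 1) * N ^ (u + 1)
          = ((z - u) * N) * (z.descFactorial u * N ^ u) := by
            rw [Nat.descFactorial_succ]; ring
        _ ≤ (z * (N - u)) * (z ^ u * N.descFactorial u) := Nat.mul_le_mul h1 ih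
        _ = _ := by rw [Nat.descFactorial_succ]; ring
  rw [Nat.descFactorial_eq_factorial_mul_choose, Nat.descFactorial_eq_factorial_mul_choose] at key
  refine Nat.le_of_mul_le_mul_left ?_ u.factorial_pos
  linarith

lemma sum_powerset_apply_card_real {α : Type*} (s : Finset α) (F : ℕ → ℝ) :
    ∑ U ∈ s.powerset, F U.card = ∑ u ∈ range (s.card + 1), (s.card.choose u : ℝ) * F u := by
  simpa using sum_powerset_apply_card F (x := s)

lemma binomial_sum_eq_one (N : ℕ) (p : ℝ) :
    ∑ u ∈ range (N + 1), (N.choose u : ℝ) * (p ^ (N - u) * (1 - p) ^ u) = 1 := by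
  have := add_pow (1 - p) p N
  rw [sub_add_cancel, one_pow] at this
  refine Eq.trans ?_ this.symm
  exact sum_congr rfl fun u _ => by ring

/-- The probability that the set of points which are not erased has at least `n` elements and
avoids a set `Z` is at most `(1 - |Z| / |α|) ^ n`. -/
lemma sum_prob_superset_le {α : Type*} [Fintype α] [Nonempty α] (Z : Finset α) (n : ℕ) {p : ℝ}
    (hp0 : 0 ≤ p) (hp1 : p ≤ 1) :
    ∑ S : Finset α, p ^ S.card * (1 - p) ^ (Fintype.card α - S.card) *
        (if Z ⊆ S ∧ n ≤ Fintype.card α - S.card then 1 else 0) ≤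
      (1 - (Z.card : ℝ) / Fintype.card α) ^ n := by
  set N := Fintype.card α with hN
  have hNpos : (0 : ℝ) < N := by exact_mod_cast Fintype.card_pos
  have hZN : Z.card ≤ N := card_le_univ Z
  have hq : 0 ≤ 1 - p := by linarith
  have hzc : (Zᶜ).card = N - Z.card := by rw [card_compl]
  have hratio : 1 - (Z.card : ℝ) / N = ((Zᶜ).card : ℝ) / N := by
    rw [hzc, Nat.cast_sub hZN]; field_simp
  set z := (Zᶜ).card with hz
  have hzN : z ≤ N := card_le_univ _
  calc _ = ∑ U : Finset α, p ^ (N - U.card) * (1 - p) ^ U.card *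
        (if U ⊆ Zᶜ ∧ n ≤ U.card then 1 else 0) := by
        refine Fintype.sum_equiv ⟨compl, compl, compl_compl, compl_compl⟩ _ _ fun S => ?_
        have hS : S.card ≤ N := card_le_univ S
        simp only [Equiv.coe_fn_mk, card_compl, ← hN, compl_subset_compl]
        rw [Nat.sub_sub_self hS]
    _ = ∑ U ∈ (Zᶜ).powerset, p ^ (N - U.card) * (1 - p) ^ U.card *
        (if n ≤ U.card then 1 else 0) := by
        rw [← sum_filter_add_sum_filter_not univ (fun U : Finset α => U ⊆ Zᶜ)]
        rw [sum_eq_zero (s := filter (fun U => ¬ U ⊆ Zᶜ) univ) fun U hU => by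
          simp only [mem_filter] at hU
          simp [hU.2], add_zero]
        refine sum_congr (by ext; simp) fun U hU => ?_
        rw [mem_powerset] at hU
        simp [hU]
    _ = ∑ u ∈ range (z + 1), (z.choose u : ℝ) * (p ^ (N - u) * (1 - p) ^ u *
        (if n ≤ u then 1 else 0)) :=
        sum_powerset_apply_card_real _ fun u => p ^ (N - u) * (1 - p) ^ u *
          (if n ≤ u then 1 else 0)
    _ ≤ ∑ u ∈ range (z + 1), ((z : ℝ) / N) ^ n *
          ((N.choose u : ℝ) * (p ^ (N - u) * (1 - p) ^ u)) := by
        refine sum_le_sum fun u _ => ?_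
        split_ifs with hu
        · have h1 : (z.choose u : ℝ) ≤ ((z : ℝ) / N) ^ u * N.choose u := by
            rw [div_pow, div_mul_eq_mul_div, le_div_iff₀ (by positivity)]
            exact_mod_cast choose_mul_pow_le hzN u
          have h2 : ((z : ℝ) / N) ^ u ≤ ((z : ℝ) / N) ^ n :=
            pow_le_pow_of_le_one (by positivity)
              ((div_le_one hNpos).mpr (by exact_mod_cast hzN)) hu
          calc (z.choose u : ℝ) * (p ^ (N - u) * (1 - p) ^ u * 1)
              ≤ (((z : ℝ) / N) ^ n * N.choose u) * (p ^ (N - u) * (1 - p) ^ u * 1) := by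
                gcongr
                exact h1.trans (by gcongr)
            _ = _ := by ring
        · simp only [mul_zero]; positivity
    _ ≤ ∑ u ∈ range (N + 1), ((z : ℝ) / N) ^ n *
          ((N.choose u : ℝ) * (p ^ (N - u) * (1 - p) ^ u)) := by
        refine sum_le_sum_of_subset_of_nonneg (range_mono (by omega)) fun u _ _ => by positivity
    _ = _ := by rw [← mul_sum, binomial_sum_eq_one, mul_one, hratio]

/-- A Chernoff bound for the number of points which are not erased. -/
lemma sum_prob_card_lt_le {α : Type*} [Fintype α] (n : ℕ) {p s : ℝ}
    (hp0 : 0 ≤ p) (hp1 : p ≤ 1) (hs : 0 ≤ s) :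
    ∑ S : Finset α, p ^ S.card * (1 - p) ^ (Fintype.card α - S.card) *
        (if Fintype.card α - S.card < n then 1 else 0) ≤
      Real.exp (s * n - (1 - p) * Fintype.card α * (1 - Real.exp (-s))) := by
  set N := Fintype.card α with hN
  have hq : 0 ≤ 1 - p := by linarith
  calc _ ≤ ∑ S ∈ (univ : Finset α).powerset, p ^ S.card * (1 - p) ^ (N - S.card) *
        Real.exp (s * (n - (N - S.card : ℕ))) := by
        rw [powerset_univ]
        refine sum_le_sum fun S _ => ?_
        gcongr
        split_ifs with h
        · refine Real.one_le_exp (mul_nonneg hs ?_)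
          rw [sub_nonneg]; exact_mod_cast h.le
        · positivity
    _ = ∑ u ∈ range (N + 1), (N.choose u : ℝ) * (p ^ u * (1 - p) ^ (N - u) *
        Real.exp (s * (n - (N - u : ℕ)))) :=
        sum_powerset_apply_card_real _ fun u => p ^ u * (1 - p) ^ (N - u) *
          Real.exp (s * (n - (N - u : ℕ)))
    _ = Real.exp (s * n) * (p + (1 - p) * Real.exp (-s)) ^ N := by
        rw [add_pow, mul_sum]
        refine sum_congr rfl fun u _ => ?_
        rw [mul_pow, ← Real.exp_nat_mul, mul_sub, Real.exp_sub, Real.exp_eq_exp_ℝ]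
        rw [← Real.exp_eq_exp_ℝ, show ((N - u : ℕ) : ℝ) * -s = -(s * (N - u : ℕ)) by ring,
          Real.exp_neg]
        field_simp
    _ ≤ Real.exp (s * n) * Real.exp (-((1 - p) * (1 - Real.exp (-s)))) ^ N := by
        gcongr
        have := Real.add_one_le_exp (-((1 - p) * (1 - Real.exp (-s))))
        linarith
    _ = _ := by
        rw [← Real.exp_nat_mul, ← Real.exp_add]
        congr 1; ring

/-- The contribution of the nonzero codewords of weight at most `β` to the union bound. -/
noncomputable def unionSum (m r n : ℕ) (β : ℝ) : ℝ :=
  ∑ f : BF m with f ∈ RM m r ∧ f ≠ 0 ∧ wt f ≤ β, (1 - wt f) ^ n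

lemma unionSum_nonneg (m r n : ℕ) (β : ℝ) : 0 ≤ unionSum m r n β :=
  sum_nonneg fun f _ => pow_nonneg (by linarith [wt_le_one f]) n

lemma unionSum_eq_zero {m r : ℕ} (n : ℕ) {β : ℝ} (h : β < (1 / 2) ^ r) :
    unionSum m r n β = 0 := by
  rw [unionSum, filter_false_of_mem, sum_empty]
  rintro f - ⟨hf, hne, hβ⟩
  exact hne (eq_zero_of_wt_lt hf (hβ.trans_lt h))

lemma unionSum_le_add (m r n : ℕ) {a : ℝ} (b : ℝ) (ha : a ≤ 1) :
    unionSum m r n b ≤ unionSum m r n a + W m r b * (1 - a) ^ n := by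
  rw [unionSum, ← sum_filter_add_sum_filter_not _ (fun f => wt f ≤ a)]
  gcongr
  · refine sum_le_sum_of_subset_of_nonneg ?_ fun f _ _ =>
      pow_nonneg (by linarith [wt_le_one f]) n
    intro f
    simp only [mem_filter, mem_univ, true_and]
    tauto
  · rw [W_eq_card, ← nsmul_eq_mul, ← sum_const]
    refine (sum_le_sum (g := fun _ => (1 - a) ^ n) fun f hf => ?_).trans ?_
    · simp only [mem_filter, mem_univ, true_and, not_le] at hf
      have := wt_le_one f
      exact pow_le_pow_left₀ (by linarith) (by linarith) n
    · refine sum_le_sum_of_subset_of_nonneg ?_ fun f _ _ => pow_nonneg (by linarith) n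
      intro f
      simp only [mem_filter, mem_univ, true_and]
      tauto

lemma erasureFailProb_nonneg (m r : ℕ) {p : ℝ} (hp0 : 0 ≤ p) (hp1 : p ≤ 1) :
    0 ≤ erasureFailProb m r p := by
  have : 0 ≤ 1 - p := by linarith
  refine sum_nonneg fun S _ => mul_nonneg (by positivity) ?_
  split_ifs <;> norm_num

lemma erasureFailProb_le (m r n : ℕ) {p s : ℝ} (hp0 : 0 ≤ p) (hp1 : p ≤ 1) (hs : 0 ≤ s) :
    erasureFailProb m r p ≤
      Real.exp (s * n - (1 - p) * 2 ^ m * (1 - Real.exp (-s))) + unionSum m r n 1 := by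
  have hq : 0 ≤ 1 - p := by linarith
  have h1 := sum_prob_card_lt_le (α := Cube m) n hp0 hp1 hs
  have h2 : ∀ f : BF m, _ := fun f =>
    sum_prob_superset_le (univ.filter fun x => f x = 1) n hp0 hp1
  rw [card_cube] at h1
  simp only [card_cube] at h2
  push_cast at h1 h2
  refine le_trans ?_ (add_le_add h1 (sum_le_sum fun f _ => h2 f))
  rw [sum_comm, ← sum_add_distrib]
  refine sum_le_sum fun S _ => ?_
  rw [← mul_sum, ← mul_add]
  gcongr
  set T := univ.filter fun f : BF m => f ∈ RM m r ∧ f ≠ 0 ∧ wt f ≤ 1 with hT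
  have hnonneg : ∀ f ∈ T, (0 : ℝ) ≤
      if (univ.filter fun x => f x = 1) ⊆ S ∧ n ≤ 2 ^ m - S.card then 1 else 0 :=
    fun f _ => by split_ifs <;> norm_num
  by_cases hcard : 2 ^ m - S.card < n
  · rw [if_pos hcard]
    have := sum_nonneg hnonneg
    split_ifs <;> linarith
  · rw [if_neg hcard, zero_add]
    split_ifs with hf
    · obtain ⟨f, hf, hne, hS⟩ := hf
      have hfT : f ∈ T := by simp [hT, hf, hne, wt_le_one]
      refine le_trans ?_ (single_le_sum hnonneg hfT)
      rw [if_pos]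
      refine ⟨fun x hx => hS x ?_, by omega⟩
      simpa [zmod_two_eq_one_iff] using hx
    · exact sum_nonneg hnonneg

lemma binomLe_pos (m r : ℕ) : 0 < binomLe m r := by
  have : m.choose 0 ≤ binomLe m r :=
    single_le_sum (f := fun i => m.choose i) (fun _ _ => Nat.zero_le _) (by simp)
  simpa [Nat.one_le_iff_ne_zero, Nat.pos_iff_ne_zero] using this

lemma binomLe_le_two_pow (m r : ℕ) : binomLe m r ≤ 2 ^ m := by
  rw [← card_finset_card_le]
  refine (Fintype.card_subtype_le _).trans ?_
  simp

lemma binomLe_succ_left (m r : ℕ) :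
    binomLe (m + 1) (r + 1) = binomLe m (r + 1) + binomLe m r := by
  unfold binomLe
  rw [sum_range_succ' _ (r + 1), sum_range_succ' (fun i => m.choose i) (r + 1)]
  simp only [Nat.choose_succ_succ, sum_add_distrib, Nat.choose_zero_right]
  ring

/-- Lowering the degree by one decreases the dimension by a factor of at least `g⁻¹`. -/
lemma binomLe_pred_le {m r : ℕ} {g : ℝ} (hg : 0 ≤ g) (h : ((r + 1 : ℕ) : ℝ) ≤ g * (m - r)) :
    (binomLe m r : ℝ) ≤ g * binomLe m (r + 1) := by
  unfold binomLe
  rw [sum_range_succ' _ (r + 1)]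
  push_cast
  rw [mul_add, mul_sum]
  refine le_add_of_le_of_nonneg (sum_le_sum fun i hi => ?_) (by positivity)
  have hir : i ≤ r := by simpa [Nat.lt_succ_iff] using hi
  have hir' : (i : ℝ) ≤ r := by exact_mod_cast hir
  have hmi : ((i + 1 : ℕ) : ℝ) ≤ g * (m - i) := by
    push_cast at h ⊢
    nlinarith
  have hpos : (0 : ℝ) < m - i := by
    by_contra hneg
    push Not at hneg
    have : (0 : ℝ) < (i + 1 : ℕ) := by positivity
    nlinarith
  have him : i ≤ m := by
    have : (i : ℝ) ≤ m := by linarith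
    exact_mod_cast this
  have key := Nat.choose_succ_right_eq m i
  have key' : (m.choose (i + 1) : ℝ) * (i + 1 : ℕ) = m.choose i * (m - i) := by
    rw [← Nat.cast_sub him]; exact_mod_cast key
  rw [← mul_le_mul_iff_left₀ hpos, ← key']
  calc (m.choose (i + 1) : ℝ) * (i + 1 : ℕ) ≤ m.choose (i + 1) * (g * (m - i)) := by gcongr
    _ = _ := by ring

lemma binomLe_sub_le {m r k : ℕ} {g : ℝ} (hg : 0 ≤ g) (h : (r : ℝ) ≤ g * (m - r)) (hk : k ≤ r) :
    (binomLe m (r - k) : ℝ) ≤ g ^ k * binomLe m r := by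
  induction k with
  | zero => simp
  | succ k ih =>
    obtain ⟨s, hs⟩ : ∃ s, r - k = s + 1 := ⟨r - k - 1, by omega⟩
    have hsr : (s : ℝ) + 1 ≤ r := by
      have : s + 1 ≤ r := by omega
      exact_mod_cast this
    have h1 := binomLe_pred_le (m := m) (r := s) hg (by push_cast; nlinarith)
    rw [show r - (k + 1) = s by omega, pow_succ', mul_assoc]
    refine h1.trans ?_
    rw [← hs]
    gcongr
    exact ih (by omega)

lemma le_binomLe_of_succ {m r : ℕ} {g : ℝ} (hg : 0 ≤ g) (h : (r : ℝ) ≤ g * (m + 1)) :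
    (1 - g) * binomLe (m + 1) r ≤ binomLe m r := by
  cases r with
  | zero => simp [binomLe, hg]
  | succ r =>
    have hle : (binomLe m r : ℝ) ≤ g * binomLe (m + 1) (r + 1) := by
      unfold binomLe
      rw [sum_range_succ' _ (r + 1)]
      push_cast
      rw [mul_add, mul_sum]
      refine le_add_of_le_of_nonneg (sum_le_sum fun i hi => ?_) (by positivity)
      have hir : (i : ℝ) ≤ r := by exact_mod_cast (by simpa [Nat.lt_succ_iff] using hi)
      have key : ((m + 1 : ℕ) : ℝ) * m.choose i = (m + 1).choose (i + 1) * (i + 1 : ℕ) := by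
        exact_mod_cast Nat.add_one_mul_choose_eq m i
      have hpos : (0 : ℝ) < (m + 1 : ℕ) := by positivity
      rw [← mul_le_mul_iff_right₀ hpos, key]
      calc ((m + 1).choose (i + 1) : ℝ) * (i + 1 : ℕ)
          ≤ (m + 1).choose (i + 1) * (g * (m + 1)) := by
            gcongr
            push_cast at h ⊢
            linarith
        _ = _ := by push_cast; ring
    have := binomLe_succ_left m r
    have h2 : (binomLe (m + 1) (r + 1) : ℝ) = binomLe m (r + 1) + binomLe m r := by
      exact_mod_cast this
    rw [h2] at hle ⊢
    linarith

lemma le_binomLe_sub {m r t : ℕ} {g : ℝ} (hg : 0 ≤ g) (hg1 : g ≤ 1) (ht : t ≤ m)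
    (h : (r : ℝ) ≤ g * (m - t)) :
    (1 - g) ^ t * binomLe m r ≤ binomLe (m - t) r := by
  induction t with
  | zero => simp
  | succ t ih =>
    push_cast at h
    obtain ⟨s, hs⟩ : ∃ s, m - t = s + 1 := ⟨m - t - 1, by omega⟩
    have hsm : (m : ℝ) - t = s + 1 := by
      rw [← Nat.cast_sub (by omega), hs]; push_cast; ring
    have h1 := le_binomLe_of_succ (m := s) (r := r) hg (by nlinarith)
    rw [show m - (t + 1) = s by omega, pow_succ', mul_assoc]
    refine le_trans ?_ h1
    have h2 := ih (by omega) (by nlinarith)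
    rw [hs] at h2
    exact mul_le_mul_of_nonneg_left h2 (by linarith)

/-- One application of the approximation by products of `k`-th derivatives. -/
lemma W_le_two_rpow_of_derivatives {m r k : ℕ} {g β β' c c' : ℝ} (hg : 0 ≤ g)
    (h : (r : ℝ) ≤ g * (m - r)) (hk : k ≤ r) (hβ : 2 * ((4 ^ k - 1) * β ^ 2) ≤ β')
    (hW : (W m r β' : ℝ) ≤ 2 ^ (c' * binomLe m r)) (hc : 2 * g ^ k + c' ≤ c) :
    (W m r β : ℝ) ≤ 2 ^ (c * binomLe m r) := by
  have h1 : (W m r β : ℝ) ≤ 2 ^ (2 * binomLe m (r - k)) * W m r β' := by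
    exact_mod_cast W_le_of_derivatives k hβ
  refine h1.trans ?_
  calc (2 : ℝ) ^ (2 * binomLe m (r - k)) * W m r β'
      ≤ (2 : ℝ) ^ (2 * (binomLe m (r - k) : ℝ)) * 2 ^ (c' * binomLe m r) := by
        gcongr
        rw [← Real.rpow_natCast]; push_cast; rfl
    _ = (2 : ℝ) ^ (2 * (binomLe m (r - k) : ℝ) + c' * binomLe m r) := by
        rw [Real.rpow_add two_pos]
    _ ≤ _ := by
        refine Real.rpow_le_rpow_of_exponent_le one_le_two ?_
        have h2 := binomLe_sub_le hg h hk
        have h3 : (0 : ℝ) ≤ binomLe m r := by positivity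
        nlinarith

lemma W_le_two_rpow_of_spanAvg {m r t : ℕ} {g β β' c c' : ℝ} (hg : 0 ≤ g) (hg1 : g ≤ 1)
    (htm : t ≤ m) (h : (r : ℝ) ≤ g * (m - t)) (hβ : β < 1 / 2)
    (hβ' : 2 * ((1 - (1 - 2 * β) ^ 2) / (1 - 2 * β) ^ 2 / 2 ^ t) ≤ β')
    (hW : (W m r β' : ℝ) ≤ 2 ^ (c' * binomLe m r)) (hc : 1 - (1 - g) ^ t + c' ≤ c) :
    (W m r β : ℝ) ≤ 2 ^ (c * binomLe m r + t * m) := by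
  have h1 : (W m r β : ℝ) * 2 ^ binomLe (m - t) r ≤
      2 ^ (t * m) * 2 ^ binomLe m r * W m r β' := by
    exact_mod_cast W_le_of_spanAvg t hβ hβ'
  have h2 : (W m r β : ℝ) ≤
      2 ^ (t * m) * 2 ^ binomLe m r * W m r β' / 2 ^ binomLe (m - t) r := by
    rwa [le_div_iff₀ (by positivity)]
  refine h2.trans ?_
  calc (2 : ℝ) ^ (t * m) * 2 ^ binomLe m r * W m r β' / 2 ^ binomLe (m - t) r
      ≤ (2 : ℝ) ^ (t * m) * 2 ^ binomLe m r * 2 ^ (c' * binomLe m r) /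
          2 ^ binomLe (m - t) r := by gcongr
    _ = (2 : ℝ) ^ ((t * m : ℝ) + binomLe m r + c' * binomLe m r - binomLe (m - t) r) := by
        rw [Real.rpow_sub two_pos, Real.rpow_add two_pos, Real.rpow_add two_pos]
        norm_cast
    _ ≤ _ := by
        refine Real.rpow_le_rpow_of_exponent_le one_le_two ?_
        have h3 := le_binomLe_sub hg hg1 htm h
        have h4 : (0 : ℝ) ≤ binomLe m r := by positivity
        nlinarith

/-- The number of codewords of weight at most `4⁻ᵏ⁻¹`. -/
lemma W_quarter_pow_le {m r : ℕ} {g : ℝ} (hg : 0 ≤ g) (hg1 : g < 1)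
    (h : (r : ℝ) ≤ g * (m - r)) (k : ℕ) :
    (W m r ((1 / 4) ^ (k + 1)) : ℝ) ≤ 2 ^ (4 * g ^ k / (1 - g) * binomLe m r) := by
  have h1g : 0 < 1 - g := by linarith
  obtain ⟨d, hd⟩ : ∃ d, r ≤ k + d := ⟨r, by omega⟩
  induction d generalizing k with
  | zero =>
    have hlt : ((1 : ℝ) / 4) ^ (k + 1) < (1 / 2) ^ r := by
      calc ((1 : ℝ) / 4) ^ (k + 1) < (1 / 2) ^ (k + 1) :=
            pow_lt_pow_left₀ (by norm_num) (by norm_num) (by omega)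
        _ ≤ (1 / 2) ^ r := pow_le_pow_of_le_one (by norm_num) (by norm_num) (by omega)
    have h1 : (W m r ((1 / 4) ^ (k + 1)) : ℝ) ≤ 1 := by
      exact_mod_cast W_le_one_of_lt hlt
    refine h1.trans (Real.one_le_rpow one_le_two (by positivity))
  | succ d ih =>
    by_cases hkr : k ≤ r
    · have h1 := ih (k + 1) (by omega)
      have h4 : (4 : ℝ) ^ k * (1 / 4) ^ k = 1 := by rw [← mul_pow]; norm_num
      have h0 : (0 : ℝ) < (1 / 4) ^ k := by positivity
      have hsq : (0 : ℝ) ≤ ((1 / 4) ^ k) ^ 2 := sq_nonneg _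
      have hid : 4 * g ^ k / (1 - g) = 4 * g ^ k + 4 * g ^ (k + 1) / (1 - g) := by
        field_simp; ring
      have h2 : (W m r ((1 / 4) ^ (k + 1) / 2) : ℝ) ≤
          2 ^ ((2 * g ^ k + 4 * g ^ (k + 1) / (1 - g)) * binomLe m r) := by
        refine W_le_two_rpow_of_derivatives hg h hkr ?_ h1 le_rfl
        rw [pow_succ _ (k + 1), pow_succ _ k]
        linear_combination h0.le / 32 + (1 / 4) ^ k / 32 * h4 + hsq / 32
      refine W_le_two_rpow_of_derivatives hg h hkr ?_ h2 (by rw [hid]; linarith)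
      rw [pow_succ _ k]
      linear_combination (1 / 4) ^ k / 8 * h4 + hsq / 8
    · exact ih k (by omega)

/-- The logarithmic form of a numerical inequality `(1 - a) ^ d * 2 ^ n < 1`. -/
lemma mul_log_two_add_log_neg {x : ℝ} (hx : 0 < x) (d n : ℕ) (hd : 0 < d)
    (h : x ^ d * 2 ^ n < 1) : (n / d : ℝ) * Real.log 2 + Real.log x < 0 := by
  have h1 := Real.log_neg (by positivity) h
  rw [Real.log_mul (by positivity) (by positivity), Real.log_pow, Real.log_pow] at h1
  have hd' : (0 : ℝ) < d := by exact_mod_cast hd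
  have h2 : ((n / d : ℝ) * Real.log 2 + Real.log x) * d < 0 := by
    have : ((n / d : ℝ) * Real.log 2 + Real.log x) * d = d * Real.log x + n * Real.log 2 := by
      field_simp; ring
    rw [this]; exact h1
  exact neg_of_mul_neg_left h2 hd'.le

lemma tendsto_exp_sub_sq {c : ℝ} (hc : 0 < c) (A : ℝ) :
    Filter.Tendsto (fun m : ℕ => Real.exp (A * m - c * (m : ℝ) ^ 2)) Filter.atTop (nhds 0) := by
  refine Real.tendsto_exp_atBot.comp ?_
  have h1 : Filter.Tendsto (fun m : ℕ => (m : ℝ)) Filter.atTop Filter.atTop :=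
    tendsto_natCast_atTop_atTop
  have h2 : Filter.Tendsto (fun m : ℕ => A - c * (m : ℝ)) Filter.atTop Filter.atBot := by
    simpa [sub_eq_add_neg] using Filter.tendsto_atBot_add_const_left _ A
      (Filter.tendsto_neg_atTop_atBot.comp (h1.const_mul_atTop hc))
  refine (h1.atTop_mul_atBot₀ h2).congr fun m => ?_
  ring

/-- If the low weight codewords up to `a` are negligible and the number of codewords of weight at
most `b` is small compared to `(1 - a) ^ n`, then the codewords up to `b` are negligible. -/
lemma tendsto_unionSum_of_W_le {r n : ℕ → ℕ} {κ : ℝ} (hκ : 0 < κ)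
    (hK : ∀ᶠ m : ℕ in Filter.atTop, κ * (m : ℝ) ^ 2 ≤ binomLe m (r m))
    (hn : ∀ m, binomLe m (r m) ≤ n m) {a b c : ℝ} (t : ℕ) (ha0 : 0 ≤ a) (ha1 : a < 1)
    (hW : ∀ᶠ m : ℕ in Filter.atTop, (W m (r m) b : ℝ) ≤ 2 ^ (c * binomLe m (r m) + t * m))
    (hc : c * Real.log 2 + Real.log (1 - a) < 0)
    (hU : Filter.Tendsto (fun m => unionSum m (r m) (n m) a) Filter.atTop (nhds 0)) :
    Filter.Tendsto (fun m => unionSum m (r m) (n m) b) Filter.atTop (nhds 0) := by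
  have h1a : 0 < 1 - a := by linarith
  set ε := -(c * Real.log 2 + Real.log (1 - a)) with hε
  have hε0 : 0 < ε := by linarith
  have hlim := hU.add (tendsto_exp_sub_sq (mul_pos hε0 hκ) (t * Real.log 2))
  rw [add_zero] at hlim
  refine tendsto_of_tendsto_of_tendsto_of_le_of_le' tendsto_const_nhds hlim
    (Filter.Eventually.of_forall fun m => unionSum_nonneg _ _ _ _) ?_
  filter_upwards [hK, hW] with m hKm hWm
  refine (unionSum_le_add m (r m) (n m) b ha1.le).trans ?_
  gcongr
  calc (W m (r m) b : ℝ) * (1 - a) ^ n m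
      ≤ 2 ^ (c * binomLe m (r m) + t * m) * (1 - a) ^ binomLe m (r m) := by
        refine mul_le_mul hWm ?_ (by positivity) (by positivity)
        exact pow_le_pow_of_le_one h1a.le (by linarith) (hn m)
    _ = Real.exp (t * Real.log 2 * m - ε * binomLe m (r m)) := by
        rw [Real.rpow_def_of_pos two_pos, ← Real.exp_log h1a, ← Real.exp_nat_mul,
          ← Real.exp_add, hε]
        congr 1; ring
    _ ≤ _ := by
        have := mul_le_mul_of_nonneg_left hKm hε0.le
        exact Real.exp_le_exp.mpr (by linarith)

/-- The constant bounding the ratio of consecutive dimensions `binomLe m s`. -/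
noncomputable def dimRatio : ℝ := 41 / 2000

/-- Codewords of weight at most `4⁻ᵏ⁻¹` contribute little once `k ≥ 2`. -/
lemma unionSum_quarter_pow_le {m r n : ℕ} (h : (r : ℝ) ≤ dimRatio * (m - r))
    (hn : binomLe m r ≤ n) {k d : ℕ} (hk : 2 ≤ k) (hd : r ≤ k + d) :
    unionSum m r n ((1 / 4) ^ (k + 1)) ≤
      d * Real.exp (-((1 / 2) ^ r * binomLe m r / 8)) := by
  induction d generalizing k with
  | zero =>
    rw [unionSum_eq_zero]
    · simp
    calc ((1 : ℝ) / 4) ^ (k + 1) < (1 / 2) ^ (k + 1) :=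
          pow_lt_pow_left₀ (by norm_num) (by norm_num) (by omega)
      _ ≤ (1 / 2) ^ r := pow_le_pow_of_le_one (by norm_num) (by norm_num) (by omega)
  | succ d ih =>
    by_cases hlt : ((1 : ℝ) / 4) ^ (k + 1) < (1 / 2) ^ r
    · rw [unionSum_eq_zero n hlt]
      positivity
    push Not at hlt
    have ha1 : ((1 : ℝ) / 4) ^ (k + 1 + 1) ≤ 1 := pow_le_one₀ (by norm_num) (by norm_num)
    refine (unionSum_le_add m r n _ ha1).trans ?_
    push_cast
    rw [add_one_mul]
    refine add_le_add (ih (by omega) (by omega)) ?_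
    have hK : (0 : ℝ) ≤ binomLe m r := by positivity
    have hW := W_quarter_pow_le (by norm_num [dimRatio]) (by norm_num [dimRatio]) h k
    have hcost : 4 * dimRatio ^ k / (1 - dimRatio) * Real.log 2 ≤ (1 / 4) ^ k / 32 := by
      have h4 : (4 * dimRatio) ^ k ≤ (4 * dimRatio) ^ 2 :=
        pow_le_pow_of_le_one (by norm_num [dimRatio]) (by norm_num [dimRatio]) hk
      have hq : dimRatio ^ k = (4 * dimRatio) ^ k * (1 / 4) ^ k := by
        rw [← mul_pow]; congr 1; ring
      have h0 : (0 : ℝ) < (1 / 4) ^ k := by positivity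
      have hlog := Real.log_two_lt_d9
      have hlog0 := Real.log_pos one_lt_two
      rw [hq]
      calc 4 * ((4 * dimRatio) ^ k * (1 / 4) ^ k) / (1 - dimRatio) * Real.log 2
          ≤ 4 * ((4 * dimRatio) ^ 2 * (1 / 4) ^ k) / (1 - dimRatio) * (7 / 10) := by
            have : 0 < 1 - dimRatio := by norm_num [dimRatio]
            gcongr
            linarith
        _ = 4 * (4 * dimRatio) ^ 2 / (1 - dimRatio) * (7 / 10) * (1 / 4) ^ k := by ring
        _ ≤ 1 / 32 * (1 / 4) ^ k := by
            gcongr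
            norm_num [dimRatio]
        _ = _ := by ring
    calc (W m r ((1 / 4) ^ (k + 1)) : ℝ) * (1 - (1 / 4) ^ (k + 1 + 1)) ^ n
        ≤ 2 ^ (4 * dimRatio ^ k / (1 - dimRatio) * binomLe m r) *
            (Real.exp (-(1 / 4) ^ (k + 1 + 1))) ^ binomLe m r := by
          refine mul_le_mul hW ?_ (pow_nonneg (by linarith) _) (by positivity)
          refine (pow_le_pow_of_le_one (by linarith) ?_ hn).trans ?_
          · have : (0 : ℝ) < (1 / 4) ^ (k + 1 + 1) := by positivity
            linarith
          · refine pow_le_pow_left₀ (by linarith) ?_ _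
            have := Real.add_one_le_exp (-((1 : ℝ) / 4) ^ (k + 1 + 1))
            linarith
      _ = Real.exp (4 * dimRatio ^ k / (1 - dimRatio) * Real.log 2 * binomLe m r -
            (1 / 4) ^ (k + 1 + 1) * binomLe m r) := by
          rw [Real.rpow_def_of_pos two_pos, ← Real.exp_nat_mul, ← Real.exp_add]
          congr 1; ring
      _ ≤ _ := by
          gcongr
          have h1 := mul_le_mul_of_nonneg_right hcost hK
          have h2 := mul_le_mul_of_nonneg_right hlt hK
          rw [pow_succ _ (k + 1), pow_succ _ k] at *
          linarith

/-- Numbers of codewords of weights up to `1/8`. -/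
lemma W_le_of_le_eighth {m r : ℕ} (h : (r : ℝ) ≤ dimRatio * (m - r)) (hr : 2 ≤ r) :
    (W m r (1 / 32) : ℝ) ≤ 2 ^ ((1 / 100 : ℝ) * binomLe m r) ∧
    (W m r (1 / 16) : ℝ) ≤ 2 ^ ((9 / 200 : ℝ) * binomLe m r) ∧
    (W m r (1 / 10) : ℝ) ≤ 2 ^ ((9 / 100 : ℝ) * binomLe m r) ∧
    (W m r (1 / 8) : ℝ) ≤ 2 ^ ((15 / 100 : ℝ) * binomLe m r) := by
  have hg : 0 ≤ dimRatio := by norm_num [dimRatio]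
  have h64 := W_quarter_pow_le hg (by norm_num [dimRatio]) h 2
  have h48 : (W m r (1 / 48) : ℝ) ≤ 2 ^ ((2.6 / 1000 : ℝ) * binomLe m r) :=
    W_le_two_rpow_of_derivatives hg h hr (by norm_num) h64 (by norm_num [dimRatio])
  have h38 : (W m r (1 / 38) : ℝ) ≤ 2 ^ ((3.45 / 1000 : ℝ) * binomLe m r) :=
    W_le_two_rpow_of_derivatives hg h hr (by norm_num) h48 (by norm_num [dimRatio])
  have h34 : (W m r (1 / 34) : ℝ) ≤ 2 ^ ((5 / 1000 : ℝ) * binomLe m r) :=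
    W_le_two_rpow_of_derivatives hg h hr (by norm_num) h38 (by norm_num [dimRatio])
  have h32 : (W m r (1 / 32) : ℝ) ≤ 2 ^ ((1 / 100 : ℝ) * binomLe m r) :=
    W_le_two_rpow_of_derivatives hg h hr (by norm_num) h34 (by norm_num [dimRatio])
  have hr1 : 1 ≤ r := by omega
  have h16 : (W m r (1 / 16) : ℝ) ≤ 2 ^ ((9 / 200 : ℝ) * binomLe m r) :=
    W_le_two_rpow_of_derivatives hg h hr1 (by norm_num) h38 (by norm_num [dimRatio])
  have h10 : (W m r (1 / 10) : ℝ) ≤ 2 ^ ((9 / 100 : ℝ) * binomLe m r) :=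
    W_le_two_rpow_of_derivatives hg h hr1 (by norm_num) h16 (by norm_num [dimRatio])
  exact ⟨h32, h16, h10,
    W_le_two_rpow_of_derivatives hg h hr1 (by norm_num) h10 (by norm_num [dimRatio])⟩

lemma W_quarter_le {m r : ℕ} (h : (r : ℝ) ≤ dimRatio * (m - r)) (hr : 2 ≤ r)
    (hm : 7 ≤ m) (h7 : (r : ℝ) ≤ dimRatio * (m - (7 : ℕ))) :
    (W m r (1 / 4) : ℝ) ≤ 2 ^ ((19 / 100 : ℝ) * binomLe m r + (7 : ℕ) * m) :=
  W_le_two_rpow_of_spanAvg (by norm_num [dimRatio]) (by norm_num [dimRatio]) hm h7 (by norm_num)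
    (by norm_num) (W_le_of_le_eighth h hr).2.1 (by norm_num [dimRatio])

lemma W_half_sub_le {m r : ℕ} (h : (r : ℝ) ≤ dimRatio * (m - r)) (j : ℕ)
    (hm : 4 * j + 7 ≤ m) (ht : (r : ℝ) ≤ dimRatio * (m - (4 * j + 7 : ℕ))) :
    (W m r ((1 - (1 / 2) ^ (j + 1)) / 2) : ℝ) ≤
      2 ^ ((1 - (1 - dimRatio) ^ (4 * j + 7) + 4 * dimRatio ^ (j + 1) / (1 - dimRatio)) *
        binomLe m r + (4 * j + 7 : ℕ) * m) := by
  have h0 : (0 : ℝ) < (1 / 2) ^ (j + 1) := by positivity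
  refine W_le_two_rpow_of_spanAvg (by norm_num [dimRatio]) (by norm_num [dimRatio]) hm ht
    (by linarith) ?_ (W_quarter_pow_le (by norm_num [dimRatio]) (by norm_num [dimRatio]) h (j + 1))
    le_rfl
  have e1 : (1 : ℝ) - 2 * ((1 - (1 / 2) ^ (j + 1)) / 2) = (1 / 2) ^ (j + 1) := by ring
  have e2 : ((1 : ℝ) / 4) ^ (j + 1 + 1) = ((1 / 2) ^ (j + 1)) ^ 2 / 4 := by
    rw [← pow_mul, mul_comm, pow_mul, pow_succ]; norm_num; ring
  have e3 : (2 : ℝ) ^ (4 * j + 7) = 8 / ((1 / 2) ^ (j + 1)) ^ 4 := by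
    rw [← pow_mul, one_div, inv_pow, div_inv_eq_mul,
      show (j + 1) * 4 = (4 * j + 7) - 3 by omega, ← pow_mul_pow_sub 2 (show 3 ≤ 4 * j + 7 by omega)]
    norm_num
  rw [e1, e2, e3]
  set ε : ℝ := (1 / 2) ^ (j + 1)
  have : 2 * ((1 - ε ^ 2) / ε ^ 2 / (8 / ε ^ 4)) = (1 - ε ^ 2) * ε ^ 2 / 4 := by
    field_simp; ring
  rw [this]
  nlinarith [sq_nonneg (ε ^ 2)]

lemma half_sub_cost_neg {j : ℕ} (hj : 1 ≤ j) :
    (1 - (1 - dimRatio) ^ (4 * j + 7) + 4 * dimRatio ^ (j + 1) / (1 - dimRatio)) * Real.log 2 +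
      Real.log (1 - (1 - (1 / 2) ^ j) / 2) < 0 := by
  have h1 : 3 / 2 * (1 / 2) ^ j ≤ (1 - dimRatio) ^ (4 * j + 7) := by
    induction j, hj using Nat.le_induction with
    | base => norm_num [dimRatio]
    | succ j hj ih =>
      have h4 : (1 : ℝ) / 2 ≤ (1 - dimRatio) ^ 4 := by norm_num [dimRatio]
      rw [show 4 * (j + 1) + 7 = (4 * j + 7) + 4 by ring, pow_add _ (4 * j + 7), pow_succ,
        ← mul_assoc]
      exact mul_le_mul ih h4 (by norm_num) (pow_nonneg (by norm_num [dimRatio]) _)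
  have h2 : 4 * dimRatio ^ (j + 1) / (1 - dimRatio) ≤ 1 / 100 * (1 / 2) ^ j := by
    clear h1
    induction j, hj using Nat.le_induction with
    | base => norm_num [dimRatio]
    | succ j hj ih =>
      have h0 : 0 ≤ 4 * dimRatio ^ (j + 1) / (1 - dimRatio) := by
        have : 0 ≤ 1 - dimRatio := by norm_num [dimRatio]
        have : 0 ≤ dimRatio := by norm_num [dimRatio]
        positivity
      calc 4 * dimRatio ^ (j + 1 + 1) / (1 - dimRatio)
          = 4 * dimRatio ^ (j + 1) / (1 - dimRatio) * dimRatio := by ring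
        _ ≤ 1 / 100 * (1 / 2) ^ j * (1 / 2) := by
            refine mul_le_mul ih ?_ ?_ (by positivity) <;> norm_num [dimRatio]
        _ = _ := by ring
  have hx : (0 : ℝ) < (1 / 2) ^ j := by positivity
  set x : ℝ := (1 / 2) ^ j
  have h3 : Real.log (1 - (1 - x) / 2) = Real.log (1 + x) - Real.log 2 := by
    rw [← Real.log_div (by positivity) two_ne_zero]; congr 1; ring
  have h4 : Real.log (1 + x) ≤ x := by
    have := Real.log_le_sub_one_of_pos (show 0 < 1 + x by positivity)
    linarith
  have h5 := Real.log_two_gt_d9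
  rw [h3]
  have h6 : (3 / 2 - 1 / 100) * x * Real.log 2 ≤
      ((1 - dimRatio) ^ (4 * j + 7) - 4 * dimRatio ^ (j + 1) / (1 - dimRatio)) * Real.log 2 := by
    gcongr
    linarith
  nlinarith

section Asymptotics

variable {γ : ℝ}

lemma eventually_ceil_le_dimRatio (hγ : γ ≤ 1 / 50) (t : ℕ) :
    ∀ᶠ m : ℕ in Filter.atTop,
      t ≤ m ∧ (⌈γ * m⌉₊ : ℝ) ≤ dimRatio * (m - t) ∧
        (⌈γ * m⌉₊ : ℝ) ≤ dimRatio * (m - ⌈γ * m⌉₊) := by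
  filter_upwards [Filter.eventually_ge_atTop (t + 42000 + 41 * t)] with m hm
  have hm' : ((t + 42000 + 41 * t : ℕ) : ℝ) ≤ m := by exact_mod_cast hm
  push_cast at hm'
  have hr : (⌈γ * m⌉₊ : ℝ) ≤ m / 50 + 1 := by
    have h0 : (0 : ℝ) ≤ m / 50 := by positivity
    calc (⌈γ * m⌉₊ : ℝ) ≤ ⌈(m : ℝ) / 50⌉₊ := by
          gcongr
          nlinarith [Nat.cast_nonneg (α := ℝ) m]
      _ ≤ _ := (Nat.ceil_lt_add_one h0).le
  have ht : (0 : ℝ) ≤ t := by positivity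
  refine ⟨by omega, ?_, ?_⟩ <;> unfold dimRatio <;> linarith

lemma sq_le_half_pow_mul_binomLe {m r : ℕ} (h : (r : ℝ) ≤ dimRatio * (m - r)) :
    (r : ℝ) ^ 2 ≤ (1 / 2) ^ r * binomLe m r := by
  have h1 := binomLe_sub_le (by norm_num [dimRatio]) h le_rfl
  have h2 : (1 : ℝ) ≤ binomLe m (r - r) := by exact_mod_cast binomLe_pos m (r - r)
  have h3 : dimRatio ^ r ≤ (1 / 8) ^ r :=
    pow_le_pow_left₀ (by norm_num [dimRatio]) (by norm_num [dimRatio]) r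
  have h4 : (r : ℝ) ≤ 2 ^ r := by exact_mod_cast Nat.lt_two_pow_self.le
  have hK : (0 : ℝ) ≤ binomLe m r := by positivity
  have h5 : (1 : ℝ) ≤ (1 / 8) ^ r * binomLe m r :=
    h2.trans (h1.trans (mul_le_mul_of_nonneg_right h3 hK))
  calc (r : ℝ) ^ 2 ≤ ((2 : ℝ) ^ r) ^ 2 := by gcongr
    _ ≤ ((2 : ℝ) ^ r) ^ 2 * ((1 / 8) ^ r * (binomLe m r : ℝ)) := le_mul_of_one_le_right (by positivity) h5
    _ = (2 ^ 2 * (1 / 8)) ^ r * (binomLe m r : ℝ) := by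
        rw [mul_pow, ← pow_mul, ← pow_mul, mul_comm r 2]; ring
    _ = (1 / 2) ^ r * (binomLe m r : ℝ) := by norm_num

lemma eventually_sq_le (hγ0 : 0 < γ) (hγ : γ ≤ 1 / 50) :
    ∀ᶠ m : ℕ in Filter.atTop,
      γ ^ 2 * (m : ℝ) ^ 2 ≤ (1 / 2) ^ ⌈γ * m⌉₊ * binomLe m ⌈γ * m⌉₊ := by
  filter_upwards [eventually_ceil_le_dimRatio hγ 0] with m hm
  refine le_trans ?_ (sq_le_half_pow_mul_binomLe hm.2.2)
  rw [← mul_pow]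
  gcongr
  exact Nat.le_ceil _

lemma eventually_sq_le_binomLe (hγ0 : 0 < γ) (hγ : γ ≤ 1 / 50) :
    ∀ᶠ m : ℕ in Filter.atTop, γ ^ 2 * (m : ℝ) ^ 2 ≤ binomLe m ⌈γ * m⌉₊ := by
  filter_upwards [eventually_sq_le hγ0 hγ] with m hm
  exact hm.trans (mul_le_of_le_one_left (by positivity) (pow_le_one₀ (by norm_num) (by norm_num)))

lemma tendsto_unionSum_sixty_fourth (hγ0 : 0 < γ) (hγ : γ ≤ 1 / 50) {n : ℕ → ℕ}
    (hn : ∀ m, binomLe m ⌈γ * m⌉₊ ≤ n m) :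
    Filter.Tendsto (fun m => unionSum m ⌈γ * m⌉₊ (n m) (1 / 64)) Filter.atTop (nhds 0) := by
  refine tendsto_of_tendsto_of_tendsto_of_le_of_le' tendsto_const_nhds
    (tendsto_exp_sub_sq (show 0 < γ ^ 2 / 8 by positivity) 1)
    (Filter.Eventually.of_forall fun m => unionSum_nonneg _ _ _ _) ?_
  filter_upwards [eventually_ceil_le_dimRatio hγ 0, eventually_sq_le hγ0 hγ] with m h1 h2
  have h3 : ⌈γ * m⌉₊ ≤ m := Nat.ceil_le.mpr (by nlinarith [Nat.cast_nonneg (α := ℝ) m])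
  have h4 := unionSum_quarter_pow_le h1.2.2 (hn m) le_rfl (show ⌈γ * m⌉₊ ≤ 2 + m by omega)
  norm_num at h4 ⊢
  refine h4.trans ?_
  rw [sub_eq_add_neg, Real.exp_add]
  gcongr
  · have := Real.add_one_le_exp (m : ℝ)
    linarith
  · norm_num at h2 ⊢
    linarith

lemma tendsto_unionSum_quarter (hγ0 : 0 < γ) (hγ : γ ≤ 1 / 50) {n : ℕ → ℕ}
    (hn : ∀ m, binomLe m ⌈γ * m⌉₊ ≤ n m) :
    Filter.Tendsto (fun m => unionSum m ⌈γ * m⌉₊ (n m) (1 / 4)) Filter.atTop (nhds 0) := by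
  have hκ : 0 < γ ^ 2 := by positivity
  have hK := eventually_sq_le_binomLe hγ0 hγ
  have hr2 : ∀ᶠ m : ℕ in Filter.atTop, 2 ≤ ⌈γ * m⌉₊ := by
    filter_upwards [(tendsto_natCast_atTop_atTop.const_mul_atTop hγ0).eventually_ge_atTop
      (2 : ℝ)] with m hm
    exact_mod_cast hm.trans (Nat.le_ceil _)
  have hW := ((eventually_ceil_le_dimRatio hγ 0).and hr2).mono
    fun m h => W_le_of_le_eighth h.1.2.2 h.2
  have hlog : ∀ {c a : ℝ} (d k : ℕ), 0 < d → c = k / d → 0 < 1 - a →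
      (1 - a) ^ d * 2 ^ k < 1 → c * Real.log 2 + Real.log (1 - a) < 0 := by
    rintro c a d k hd rfl ha h
    exact mul_log_two_add_log_neg ha d k hd h
  have u32 := tendsto_unionSum_of_W_le (b := 1 / 32) (c := 1 / 100) hκ hK hn 0 (by norm_num)
    (by norm_num) (by filter_upwards [hW] with m h; simpa using h.1)
    (hlog 100 1 (by norm_num) (by norm_num) (by norm_num) (by norm_num))
    (tendsto_unionSum_sixty_fourth hγ0 hγ hn)
  have u16 := tendsto_unionSum_of_W_le (b := 1 / 16) (c := 9 / 200) hκ hK hn 0 (by norm_num)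
    (by norm_num) (by filter_upwards [hW] with m h; simpa using h.2.1)
    (hlog 200 9 (by norm_num) (by norm_num) (by norm_num) (by norm_num)) u32
  have u10 := tendsto_unionSum_of_W_le (b := 1 / 10) (c := 9 / 100) hκ hK hn 0 (by norm_num)
    (by norm_num) (by filter_upwards [hW] with m h; simpa using h.2.2.1)
    (hlog 100 9 (by norm_num) (by norm_num) (by norm_num) (by norm_num)) u16
  have u8 := tendsto_unionSum_of_W_le (b := 1 / 8) (c := 15 / 100) hκ hK hn 0 (by norm_num)
    (by norm_num) (by filter_upwards [hW] with m h; simpa using h.2.2.2)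
    (hlog 100 15 (by norm_num) (by norm_num) (by norm_num) (by norm_num)) u10
  refine tendsto_unionSum_of_W_le (c := 19 / 100) hκ hK hn 7 (by norm_num) (by norm_num) ?_
    (hlog 100 19 (by norm_num) (by norm_num) (by norm_num) (by norm_num)) u8
  filter_upwards [eventually_ceil_le_dimRatio hγ 7, hr2] with m h1 h2
  exact W_quarter_le h1.2.2 h2 h1.1 h1.2.1

lemma tendsto_unionSum_half_sub (hγ0 : 0 < γ) (hγ : γ ≤ 1 / 50) {n : ℕ → ℕ}
    (hn : ∀ m, binomLe m ⌈γ * m⌉₊ ≤ n m) {j : ℕ} (hj : 1 ≤ j) :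
    Filter.Tendsto (fun m => unionSum m ⌈γ * m⌉₊ (n m) ((1 - (1 / 2) ^ j) / 2))
      Filter.atTop (nhds 0) := by
  induction j, hj using Nat.le_induction with
  | base =>
    convert tendsto_unionSum_quarter hγ0 hγ hn using 3
    norm_num
  | succ j hj ih =>
    have h0 : (0 : ℝ) < (1 / 2) ^ j := by positivity
    have h1 : ((1 : ℝ) / 2) ^ j ≤ 1 := pow_le_one₀ (by norm_num) (by norm_num)
    refine tendsto_unionSum_of_W_le (show 0 < γ ^ 2 by positivity)
      (eventually_sq_le_binomLe hγ0 hγ) hn (4 * j + 7) (by linarith) (by linarith) ?_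
      (half_sub_cost_neg hj) ih
    filter_upwards [eventually_ceil_le_dimRatio hγ (4 * j + 7)] with m h
    exact W_half_sub_le h.2.2 j h.1 h.2.1

/-- The union bound over all nonzero codewords, for slightly more unerased points than the
dimension. -/
lemma tendsto_unionSum_one (hγ0 : 0 < γ) (hγ : γ ≤ 1 / 50) {n : ℕ → ℕ} {η : ℝ} (hη : 0 < η)
    (hn : ∀ m, (1 + η) * binomLe m ⌈γ * m⌉₊ ≤ n m) :
    Filter.Tendsto (fun m => unionSum m ⌈γ * m⌉₊ (n m) 1) Filter.atTop (nhds 0) := by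
  have hn' : ∀ m, binomLe m ⌈γ * m⌉₊ ≤ n m := fun m => by
    have h0 : (0 : ℝ) ≤ binomLe m ⌈γ * m⌉₊ := by positivity
    have : (binomLe m ⌈γ * m⌉₊ : ℝ) ≤ n m := by nlinarith [hn m]
    exact_mod_cast this
  have hlog2 := Real.log_pos one_lt_two
  obtain ⟨j, hj⟩ := exists_pow_lt_of_lt_one
    (show 0 < η * Real.log 2 / (1 + η) by positivity) (show (1 / 2 : ℝ) < 1 by norm_num)
  have hj' : ((1 : ℝ) / 2) ^ (j + 1) < η * Real.log 2 / (1 + η) := by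
    refine lt_of_le_of_lt ?_ hj
    exact pow_le_pow_of_le_one (by norm_num) (by norm_num) (by omega)
  set x : ℝ := (1 / 2) ^ (j + 1) with hx
  have hx0 : 0 < x := by positivity
  have hx1 : x ≤ 1 := pow_le_one₀ (by norm_num) (by norm_num)
  rw [lt_div_iff₀ (by positivity)] at hj'
  set ε := η * Real.log 2 - x * (1 + η) with hε
  have hε0 : 0 < ε := by linarith
  have hlim := (tendsto_unionSum_half_sub hγ0 hγ hn' (show 1 ≤ j + 1 by omega)).add
    (tendsto_exp_sub_sq (show 0 < ε * γ ^ 2 by positivity) 0)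
  rw [add_zero, ← hx] at hlim
  refine tendsto_of_tendsto_of_tendsto_of_le_of_le' tendsto_const_nhds hlim
    (Filter.Eventually.of_forall fun m => unionSum_nonneg _ _ _ _) ?_
  filter_upwards [eventually_sq_le_binomLe hγ0 hγ] with m hm
  refine (unionSum_le_add m _ (n m) 1 (show (1 - x) / 2 ≤ 1 by linarith)).trans ?_
  gcongr
  have hW : (W m ⌈γ * m⌉₊ 1 : ℝ) ≤ 2 ^ binomLe m ⌈γ * m⌉₊ := by
    exact_mod_cast W_le_two_pow m _ 1
  have hbase : 1 - (1 - x) / 2 ≤ Real.exp (x - Real.log 2) := by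
    rw [Real.exp_sub, Real.exp_log two_pos]
    have := Real.add_one_le_exp x
    linarith
  have hxlog : x - Real.log 2 ≤ 0 := by
    by_contra! hneg
    nlinarith
  calc (W m ⌈γ * m⌉₊ 1 : ℝ) * (1 - (1 - x) / 2) ^ n m
      ≤ 2 ^ binomLe m ⌈γ * m⌉₊ * Real.exp (x - Real.log 2) ^ n m := by
        refine mul_le_mul hW (pow_le_pow_left₀ (by linarith) hbase _)
          (pow_nonneg (by linarith) _) (by positivity)
    _ = Real.exp (binomLe m ⌈γ * m⌉₊ * Real.log 2 + n m * (x - Real.log 2)) := by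
        rw [Real.exp_add, Real.exp_nat_mul, Real.exp_nat_mul, Real.exp_log two_pos]
    _ ≤ _ := by
        refine Real.exp_le_exp.mpr ?_
        have h1 := mul_le_mul_of_nonpos_right (hn m) hxlog
        have h2 := mul_le_mul_of_nonneg_left hm hε0.le
        rw [hε] at h2 ⊢
        nlinarith

lemma tendsto_rate (hγ : γ ≤ 1 / 50) :
    Filter.Tendsto (fun m : ℕ => (binomLe m ⌈γ * m⌉₊ : ℝ) / 2 ^ m) Filter.atTop (nhds 0) := by
  have h1g : 0 < 1 - dimRatio := by norm_num [dimRatio]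
  rw [Metric.tendsto_nhds]
  intro ε hε
  obtain ⟨t, ht⟩ := exists_pow_lt_of_lt_one hε
    (show (1 / (2 * (1 - dimRatio)) : ℝ) < 1 by norm_num [dimRatio])
  filter_upwards [eventually_ceil_le_dimRatio hγ t] with m hm
  rw [Real.dist_eq, sub_zero, abs_of_nonneg (by positivity)]
  refine lt_of_le_of_lt ?_ ht
  have h2 := le_binomLe_sub (by norm_num [dimRatio]) (by norm_num [dimRatio]) hm.1 hm.2.1
  have h3 : (binomLe (m - t) ⌈γ * m⌉₊ : ℝ) ≤ 2 ^ (m - t) := by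
    exact_mod_cast binomLe_le_two_pow _ _
  rw [div_pow, one_pow, div_le_div_iff₀ (by positivity) (by positivity), mul_pow, one_mul]
  calc (binomLe m ⌈γ * m⌉₊ : ℝ) * (2 ^ t * (1 - dimRatio) ^ t)
      = 2 ^ t * ((1 - dimRatio) ^ t * binomLe m ⌈γ * m⌉₊) := by ring
    _ ≤ 2 ^ t * 2 ^ (m - t) := by
        gcongr
        exact h2.trans h3
    _ = 2 ^ m := pow_mul_pow_sub 2 hm.1

end Asymptotics

/-- RM codes of degree ⌈γm⌉, γ ≤ 1/50, achieve capacity for the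
binary erasure channel (Theorem `main thm - capacity for bec`). -/
theorem rm_achieves_capacity_BEC (γ δ : ℝ) (hγ0 : 0 < γ) (hγ : γ ≤ 1 / 50)
    (hδ : 0 < δ) :
    Filter.Tendsto
      (fun m : ℕ =>
        erasureFailProb m ⌈γ * m⌉₊
          (1 - (1 + δ) * ((binomLe m ⌈γ * m⌉₊ : ℝ) / 2 ^ m)))
      Filter.atTop (nhds 0) := by
  set K : ℕ → ℝ := fun m => binomLe m ⌈γ * m⌉₊ with hK
  have hK0 : ∀ m, 0 ≤ K m := fun m => by positivity
  set n : ℕ → ℕ := fun m => ⌈(1 + δ / 2) * K m⌉₊ with hn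
  set s : ℝ := δ / (4 + 3 * δ) with hs
  have hs0 : 0 < s := by positivity
  have hp0 : ∀ᶠ m : ℕ in Filter.atTop, 0 ≤ 1 - (1 + δ) * (K m / 2 ^ m) := by
    have h1 := (tendsto_rate hγ).const_mul (1 + δ)
    rw [mul_zero] at h1
    filter_upwards [h1.eventually_le_const one_pos] with m hm
    linarith
  have hlim := ((tendsto_exp_sub_sq (show 0 < s * δ / 4 * γ ^ 2 by positivity) 0).const_mul
    (Real.exp s)).add (tendsto_unionSum_one hγ0 hγ (n := n) (half_pos hδ)
      fun m => Nat.le_ceil _)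
  rw [mul_zero, zero_add] at hlim
  have hp1 : ∀ m, 1 - (1 + δ) * (K m / 2 ^ m) ≤ 1 := fun m => by
    have := hK0 m
    have : 0 ≤ (1 + δ) * (K m / 2 ^ m) := by positivity
    linarith
  refine tendsto_of_tendsto_of_tendsto_of_le_of_le' tendsto_const_nhds hlim ?_ ?_
  · filter_upwards [hp0] with m hm
    exact erasureFailProb_nonneg m _ hm (hp1 m)
  filter_upwards [hp0, eventually_sq_le_binomLe hγ0 hγ] with m hm hsq
  refine (erasureFailProb_le m _ (n m) hm (hp1 m) hs0.le).trans ?_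
  gcongr
  rw [← Real.exp_add, Real.exp_le_exp]
  have hnm : (n m : ℝ) ≤ (1 + δ / 2) * K m + 1 :=
    (Nat.ceil_lt_add_one (mul_nonneg (by positivity) (hK0 m))).le
  have hexp : s / (1 + s) ≤ 1 - Real.exp (-s) := by
    have h1 : Real.exp (-s) ≤ (1 + s)⁻¹ := by
      rw [Real.exp_neg]
      gcongr
      linarith [Real.add_one_le_exp s]
    have h2 : s / (1 + s) = 1 - (1 + s)⁻¹ := by field_simp; ring
    linarith
  have hq : (1 - (1 - (1 + δ) * (K m / 2 ^ m))) * 2 ^ m = (1 + δ) * K m := by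
    field_simp; ring
  have hs1 : (1 + δ) * (s / (1 + s)) = s * (1 + 3 * δ / 4) := by
    rw [hs]; field_simp; ring
  rw [hq]
  have h3 := mul_le_mul_of_nonneg_left hexp (mul_nonneg (show 0 ≤ 1 + δ by positivity) (hK0 m))
  have h4 : (1 + δ) * K m * (s / (1 + s)) = s * (1 + 3 * δ / 4) * K m := by rw [← hs1]; ring
  have h5 := mul_le_mul_of_nonneg_left hnm hs0.le
  have h6 := mul_le_mul_of_nonneg_left hsq (show 0 ≤ s * δ / 4 by positivity)
  have h7 : K m = binomLe m ⌈γ * m⌉₊ := rfl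
  rw [← h7] at h6
  nlinarith
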